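/- arXiv:2001.02484 — 3 statements merged into one kernel-verified Lean document; each statement's English description precedes it below -/
import Mathlib

section
/- Let {G_n : n ∈ ℕ} be a family of bridgeless cubic class 2 graphs such that for each n: G_n has an r_n-bipartition (B_n, W_n) with r_n ∈ (4,5), and G_n has a perfect matching M_n such that G_n has the M_n-class-1 property and every edge of M_n has one end in B_n and the other in W_n. If lim_{n→∞} r_n = 4, then for every integer t ≥ 2, inf{ φ_c(G) : G is a (2t+1)-regular class 1 multigraph having no perfect matching M with G − M bipartite } = 2 + 2/(2t−1). -/
/-!
Basic theory of finite multigraphs (parallel edges allowed, no loops),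
nowhere-zero `r`-flows, the circular flow number, proper edge colorings,
the chromatic index, class 1 / class 2, perfect matchings, edge cuts,
`r`-bipartitions, and the operation of adding parallel copies of a matching.
-/

/-- A finite multigraph: a finite type of vertices, a finite type of edges,
each edge having an (ordered, for reference purposes) pair of distinct endpoints.
Parallel edges are allowed; loops are excluded. -/
structure Multigraph : Type 1 where
  V : Type
  E : Type
  vFinite : Finite V
  eFinite : Finite E
  ends : E → V × V
  no_loop : ∀ e, (ends e).1 ≠ (ends e).2

namespace Multigraph

variable (G : Multigraph)

instance : Finite G.V := G.vFinite
instance : Finite G.E := G.eFinite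

/-- The first endpoint of an edge (w.r.t. the reference orientation). -/
def tail (e : G.E) : G.V := (G.ends e).1

/-- The second endpoint of an edge (w.r.t. the reference orientation). -/
def head (e : G.E) : G.V := (G.ends e).2

/-- `v` is an endpoint of the edge `e`. -/
def Inc (v : G.V) (e : G.E) : Prop := G.tail e = v ∨ G.head e = v

open Classical in
/-- The endpoint of `e` other than `v`. -/
noncomputable def otherEnd (e : G.E) (v : G.V) : G.V :=
  if G.tail e = v then G.head e else G.tail e

/-- The degree of a vertex: the number of edges incident with it
(no loops, so no edge is counted twice). -/
noncomputable def degree (v : G.V) : ℕ := Nat.card {e : G.E // G.Inc v e}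

/-- `G` is `k`-regular. -/
def IsRegular (k : ℕ) : Prop := ∀ v, G.degree v = k

/-- The maximum degree `Δ(G)`. -/
noncomputable def maxDegree : ℕ := sSup (Set.range G.degree)

/-- Two distinct edges are adjacent if they share an endpoint. -/
def EAdj (e e' : G.E) : Prop := e ≠ e' ∧ ∃ v, G.Inc v e ∧ G.Inc v e'

/-- A proper edge coloring with `k` colors: adjacent edges get distinct colors. -/
def IsProperEdgeColoring {k : ℕ} (c : G.E → Fin k) : Prop :=
  ∀ e e', G.EAdj e e' → c e ≠ c e'

/-- The chromatic index `χ'(G)`. -/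
noncomputable def chromaticIndex : ℕ :=
  sInf {k | ∃ c : G.E → Fin k, G.IsProperEdgeColoring c}

/-- `G` is class 1 if `χ'(G) = Δ(G)`. -/
def IsClass1 : Prop := G.chromaticIndex = G.maxDegree

/-- `G` is class 2 if it is not class 1. -/
def IsClass2 : Prop := ¬ G.IsClass1

/-- A nowhere-zero `r`-flow: the orientation `D` is encoded by the signs of `f`
(a negative value means the edge is used against its reference direction), every
edge has absolute flow value in `[1, r-1]`, and Kirchhoff's law holds at every
vertex. -/
def IsNZFlow (r : ℝ) (f : G.E → ℝ) : Prop :=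
  (∀ e, 1 ≤ |f e| ∧ |f e| ≤ r - 1) ∧
  ∀ v : G.V, ∑ᶠ e ∈ {e | G.tail e = v}, f e = ∑ᶠ e ∈ {e | G.head e = v}, f e

/-- `G` admits a nowhere-zero `r`-flow. -/
def HasNZFlow (r : ℝ) : Prop := ∃ f, G.IsNZFlow r f

/-- The circular flow number `φ_c(G)`, as an extended real number:
the infimum of all real `r ≥ 2` such that `G` has a nowhere-zero `r`-flow
(`+∞` if there is no such `r`, e.g. if `G` has a bridge). -/
noncomputable def flowNumber : EReal :=
  sInf {x : EReal | ∃ r : ℝ, x = (r : EReal) ∧ 2 ≤ r ∧ G.HasNZFlow r}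

/-- A perfect matching: every vertex is incident with exactly one edge of `M`. -/
def IsPerfectMatching (M : Set G.E) : Prop :=
  ∀ v, ∃! e, e ∈ M ∧ G.Inc v e

/-- `G` is bipartite: the vertices can be 2-colored with every edge bichromatic. -/
def IsBipartite : Prop :=
  ∃ s : Set G.V, ∀ e, ¬ (G.tail e ∈ s ↔ G.head e ∈ s)

/-- The edge cut `∂_G(X)`: edges with exactly one end in `X`. -/
def cut (X : Set G.V) : Set G.E := {e | ¬ (G.tail e ∈ X ↔ G.head e ∈ X)}

/-- Add, for each `i : Fin k`, one new parallel copy of each edge of `M i`. -/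
noncomputable def addEdgeFamily {k : ℕ} (M : Fin k → Set G.E) : Multigraph where
  V := G.V
  E := G.E ⊕ ((i : Fin k) × ↥(M i))
  vFinite := by infer_instance
  eFinite := by infer_instance
  ends := Sum.elim G.ends (fun p => G.ends p.2.1)
  no_loop := by
    rintro (e | ⟨i, e⟩)
    · exact G.no_loop e
    · exact G.no_loop e.1

/-- `G + kM`: add `k` new parallel copies of each edge of `M`. -/
noncomputable def addCopies (M : Set G.E) (k : ℕ) : Multigraph :=
  G.addEdgeFamily (fun _ : Fin k => M)

/-- Delete a set of edges. -/
noncomputable def deleteEdges (M : Set G.E) : Multigraph where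
  V := G.V
  E := {e : G.E // e ∉ M}
  vFinite := G.vFinite
  eFinite := by infer_instance
  ends := fun e => G.ends e.1
  no_loop := fun e => G.no_loop e.1

/-- Vertex adjacency (there is an edge between `u` and `v`). -/
def VAdj (u v : G.V) : Prop := ∃ e, G.ends e = (u, v) ∨ G.ends e = (v, u)

/-- Reachability by walks. -/
def Reach : G.V → G.V → Prop := Relation.ReflTransGen G.VAdj

/-- `G` is connected. -/
def Connected : Prop := ∀ u v, G.Reach u v

/-- An edge is a bridge if its ends are not joined by a walk avoiding it. -/
def IsBridge (e : G.E) : Prop :=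
  ¬ (G.deleteEdges {e}).Reach (G.tail e) (G.head e)

/-- `G` is bridgeless. -/
def Bridgeless : Prop := ∀ e, ¬ G.IsBridge e

/-- An `r`-bipartition of (the vertex set of) a cubic graph. -/
def IsRBipartition (r : ℝ) (B W : Set G.V) : Prop :=
  B ∪ W = Set.univ ∧ B ∩ W = ∅ ∧
  ∀ X : Set G.V,
    (r / (r - 2)) * |((X ∩ B).ncard : ℝ) - ((X ∩ W).ncard : ℝ)| ≤ ((G.cut X).ncard : ℝ)

/-- A cubic graph `G` with a perfect matching `M` has the `M`-class-2 property
if `G + (2t-2)M` is class 2 for every integer `t ≥ 1`. -/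
def MClass2Property (M : Set G.E) : Prop :=
  ∀ t : ℕ, 1 ≤ t → (G.addCopies M (2 * t - 2)).IsClass2

/-- A cubic graph `G` with a perfect matching `M` has the `M`-class-1 property
if `G + (2t-2)M` is class 1 for every integer `t ≥ 2`. -/
def MClass1Property (M : Set G.E) : Prop :=
  ∀ t : ℕ, 2 ≤ t → (G.addCopies M (2 * t - 2)).IsClass1

/-- An `r`-graph: an `r`-regular multigraph in which every odd set of vertices
is left by at least `r` edges. -/
def IsRGraph (r : ℕ) : Prop :=
  G.IsRegular r ∧ ∀ X : Set G.V, Odd X.ncard → r ≤ (G.cut X).ncard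

end Multigraph

namespace Multigraph
open Classical

noncomputable instance fintypeV (G : Multigraph) : Fintype G.V := Fintype.ofFinite _
noncomputable instance fintypeE (G : Multigraph) : Fintype G.E := Fintype.ofFinite _

/-- Signed incidence coefficient. -/
noncomputable def inco (G : Multigraph) (e : G.E) (v : G.V) : ℝ :=
  (if G.tail e = v then 1 else 0) - (if G.head e = v then 1 else 0)

theorem tail_ne_head (G : Multigraph) (e : G.E) : G.tail e ≠ G.head e := G.no_loop e

theorem inco_of_not_inc (G : Multigraph) {e : G.E} {v : G.V} (h : ¬ G.Inc v e) :
    G.inco e v = 0 := by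
  unfold Inc at h
  push Not at h
  simp [inco, h.1, h.2]

theorem inco_tail (G : Multigraph) (e : G.E) : G.inco e (G.tail e) = 1 := by
  simp [inco, (G.tail_ne_head e).symm]

theorem inco_head (G : Multigraph) (e : G.E) : G.inco e (G.head e) = -1 := by
  simp [inco, (G.tail_ne_head e)]

theorem kirchhoff_iff (G : Multigraph) (f : G.E → ℝ) (v : G.V) :
    (∑ᶠ e ∈ {e | G.tail e = v}, f e = ∑ᶠ e ∈ {e | G.head e = v}, f e) ↔
      ∑ e, G.inco e v * f e = 0 := by
  have h1 : ∀ p : G.E → Prop, ∑ᶠ e ∈ {e | p e}, f e = ∑ e, if p e then f e else 0 := by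
    intro p
    rw [finsum_mem_def, finsum_eq_sum_of_fintype]
    apply Finset.sum_congr rfl
    intro e _
    simp [Set.indicator]
  rw [h1, h1, ← sub_eq_zero, ← Finset.sum_sub_distrib]
  have : ∀ e, ((if G.tail e = v then f e else 0) - (if G.head e = v then f e else 0)) =
      G.inco e v * f e := by
    intro e
    unfold inco
    split_ifs <;> ring
  simp only [this]

theorem degree_eq_card (G : Multigraph) (v : G.V) :
    G.degree v = (Finset.univ.filter (fun e => G.Inc v e)).card := by
  unfold degree
  rw [Nat.card_eq_fintype_card, Fintype.card_subtype]

theorem maxDegree_eq (G : Multigraph) {d : ℕ} (h : G.IsRegular d) (v : G.V) :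
    G.maxDegree = d := by
  unfold maxDegree
  have : Set.range G.degree = {d} := by
    ext x
    constructor
    · rintro ⟨w, rfl⟩
      exact h w
    · rintro rfl
      exact ⟨v, h v⟩
  rw [this]; simp

theorem isClass1_of_isEmpty (G : Multigraph) (h : IsEmpty G.V) : G.IsClass1 := by
  have hE : IsEmpty G.E := ⟨fun e => h.elim (G.tail e)⟩
  unfold IsClass1 maxDegree chromaticIndex
  rw [Set.range_eq_empty]
  simp only [csSup_empty, Nat.bot_eq_zero, Nat.sInf_eq_zero]
  left
  exact ⟨fun e => hE.elim e, fun e => hE.elim e⟩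

theorem isClass1_of_coloring (G : Multigraph) {d : ℕ} (h : G.IsRegular d) (v : G.V)
    (c : G.E → Fin d) (hc : G.IsProperEdgeColoring c) : G.IsClass1 := by
  unfold IsClass1
  rw [G.maxDegree_eq h v]
  apply le_antisymm
  · exact Nat.sInf_le ⟨c, hc⟩
  · refine le_csInf (s := {k | ∃ c : G.E → Fin k, G.IsProperEdgeColoring c}) ⟨d, c, hc⟩ ?_
    rintro k ⟨c', hc'⟩
    have hd := G.degree_eq_card v
    rw [h v] at hd
    rw [hd]
    have := Finset.card_le_card_of_injOn (s := Finset.univ.filter (fun e => G.Inc v e))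
      (t := (Finset.univ : Finset (Fin k))) c' (fun _ _ => Finset.mem_coe.2 (Finset.mem_univ _)) (by
        intro e he e' he' hee
        by_contra hne
        simp at he he'
        exact hc' e e' ⟨hne, v, he, he'⟩ hee)
    simpa using this

theorem exists_coloring (G : Multigraph) {d : ℕ} (h : G.IsRegular d) (v : G.V)
    (h1 : G.IsClass1) : ∃ c : G.E → Fin d, G.IsProperEdgeColoring c := by
  unfold IsClass1 at h1
  rw [G.maxDegree_eq h v] at h1
  have hne : {k | ∃ c : G.E → Fin k, G.IsProperEdgeColoring c}.Nonempty := by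
    refine ⟨Fintype.card G.E, Fintype.equivFin G.E, ?_⟩
    intro e e' hee h
    exact hee.1 ((Fintype.equivFin G.E).injective h)
  have := Nat.sInf_mem hne
  unfold chromaticIndex at h1
  rw [h1] at this
  exact this

theorem exists_perfectMatching (G : Multigraph) {d : ℕ} (hd : 0 < d) (h : G.IsRegular d)
    (v₀ : G.V) (h1 : G.IsClass1) : ∃ N : Set G.E, G.IsPerfectMatching N := by
  obtain ⟨c, hc⟩ := G.exists_coloring h v₀ h1
  refine ⟨{e | c e = ⟨0, hd⟩}, ?_⟩
  intro v
  have hinj : Set.InjOn c (Finset.univ.filter (fun e => G.Inc v e) : Finset G.E) := by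
    intro e he e' he' hee
    by_contra hne
    simp at he he'
    exact hc e e' ⟨hne, v, he, he'⟩ hee
  have himg : (Finset.univ.filter (fun e => G.Inc v e)).image c = Finset.univ := by
    apply Finset.eq_univ_of_card
    rw [Finset.card_image_of_injOn hinj, ← G.degree_eq_card v, h v]
    simp
  have hm : (⟨0, hd⟩ : Fin d) ∈ (Finset.univ.filter (fun e => G.Inc v e)).image c := by
    rw [himg]; exact Finset.mem_univ _
  obtain ⟨e, he, hce⟩ := Finset.mem_image.1 hm
  have he' : G.Inc v e := by simpa using he
  refine ⟨e, ⟨hce, he'⟩, ?_⟩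
  rintro e2 ⟨hc2, hi2⟩
  apply hinj (by simpa using hi2) (by simpa using he')
  rw [hce]; exact hc2

theorem cut_ncard (G : Multigraph) (X : Finset G.V) : ((G.cut (X : Set G.V)).ncard : ℝ) =
    ∑ e, if (G.tail e ∈ X ↔ G.head e ∈ X) then (0 : ℝ) else 1 := by
  have : G.cut (X : Set G.V) =
      (Finset.univ.filter (fun e => ¬ (G.tail e ∈ X ↔ G.head e ∈ X)) : Finset G.E) := by
    ext e
    rw [Finset.mem_coe, Finset.mem_filter]
    exact ⟨fun h => ⟨Finset.mem_univ _, h⟩, fun h => h.2⟩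
  rw [this, Set.ncard_coe_finset, Finset.card_filter]
  push_cast
  apply Finset.sum_congr rfl
  intro e _
  by_cases h : (G.tail e ∈ X ↔ G.head e ∈ X)
  · rw [if_pos h, if_neg (not_not.2 h)]
  · rw [if_neg h, if_pos h]

/-- Feasibility of demands in the box `[-1,1]`. -/
theorem exists_div (G : Multigraph) (ω : G.V → ℝ)
    (hω : ∀ X : Finset G.V, |∑ v ∈ X, ω v| ≤ ((G.cut (X : Set G.V)).ncard : ℝ)) :
    ∃ h : G.E → ℝ, (∀ e, |h e| ≤ 1) ∧ ∀ v, ∑ e, G.inco e v * h e = ω v := by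
  have hcomp : IsCompact (Set.Icc (fun _ => -1 : G.E → ℝ) (fun _ => 1)) := isCompact_Icc
  have hne : (Set.Icc (fun _ => -1 : G.E → ℝ) (fun _ => 1)).Nonempty :=
    ⟨fun _ => 0, by constructor <;> intro e <;> norm_num⟩
  have hcont : Continuous (fun h : G.E → ℝ => ∑ v, (ω v - ∑ e, G.inco e v * h e) ^ 2) := by
    fun_prop
  obtain ⟨h, hh, hmin⟩ := hcomp.exists_isMinOn hne hcont.continuousOn
  set y : G.V → ℝ := fun v => ω v - ∑ e, G.inco e v * h e with hy
  have hb : ∀ e, -1 ≤ h e ∧ h e ≤ 1 := fun e => ⟨hh.1 e, hh.2 e⟩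
  -- perturbation
  have hpert : ∀ e δ, -1 ≤ h e + δ → h e + δ ≤ 1 →
      0 ≤ -2 * δ * (y (G.tail e) - y (G.head e)) + 2 * δ ^ 2 := by
    intro e δ h1 h2
    have hm := hmin (a := Function.update h e (h e + δ)) (by
      constructor <;> intro e'
      · by_cases hee : e' = e
        · subst hee; simpa using h1
        · simpa [hee] using (hb e').1
      · by_cases hee : e' = e
        · subst hee; simpa using h2
        · simpa [hee] using (hb e').2)
    simp only [Set.mem_ofPred_eq] at hm
    have hdiv : ∀ v, ∑ e', G.inco e' v * Function.update h e (h e + δ) e' =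
        ∑ e', G.inco e' v * h e' + G.inco e v * δ := by
      intro v
      have : ∀ e', G.inco e' v * Function.update h e (h e + δ) e' =
          G.inco e' v * h e' + if e' = e then G.inco e v * δ else 0 := by
        intro e'
        by_cases hee : e' = e
        · subst hee; simp; ring
        · simp [hee]
      simp only [this, Finset.sum_add_distrib]
      simp
    have hsq : ∀ v, (ω v - ∑ e', G.inco e' v * Function.update h e (h e + δ) e') ^ 2 =
        (ω v - ∑ e', G.inco e' v * h e') ^ 2 + ((if G.tail e = v then (-2 * δ * y v + δ ^ 2) else 0)
          + (if G.head e = v then (2 * δ * y v + δ ^ 2) else 0)) := by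
      intro v
      rw [hdiv v]
      simp only [hy]
      by_cases h3 : G.tail e = v
      · have h4 : G.head e ≠ v := fun h4 => G.tail_ne_head e (h3.trans h4.symm)
        simp only [inco, h3, h4, if_true, if_false]; ring
      · by_cases h4 : G.head e = v
        · simp only [inco, h3, h4, if_true, if_false]; ring
        · simp only [inco, h3, h4, if_false]; ring
    simp only [hsq, Finset.sum_add_distrib] at hm
    simp at hm
    linarith
  have hup : ∀ e, y (G.head e) < y (G.tail e) → h e = 1 := by
    intro e hlt
    by_contra hne
    have hl : h e < 1 := lt_of_le_of_ne (hb e).2 hne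
    set δ := min (1 - h e) ((y (G.tail e) - y (G.head e)) / 2) with hδ
    have hδ0 : 0 < δ := lt_min (by linarith) (by linarith)
    have hδ1 : δ ≤ 1 - h e := min_le_left _ _
    have hδ2 : δ ≤ (y (G.tail e) - y (G.head e)) / 2 := min_le_right _ _
    have := hpert e δ (by linarith [(hb e).1]) (by linarith)
    nlinarith
  have hdn : ∀ e, y (G.tail e) < y (G.head e) → h e = -1 := by
    intro e hlt
    by_contra hne
    have hl : -1 < h e := lt_of_le_of_ne (hb e).1 (Ne.symm hne)
    set δ := min (1 + h e) ((y (G.head e) - y (G.tail e)) / 2) with hδ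
    have hδ0 : 0 < δ := lt_min (by linarith) (by linarith)
    have hδ1 : δ ≤ 1 + h e := min_le_left _ _
    have hδ2 : δ ≤ (y (G.head e) - y (G.tail e)) / 2 := min_le_right _ _
    have := hpert e (-δ) (by linarith [(hb e).1]) (by linarith [(hb e).2])
    nlinarith
  have hsum : ∀ X : Finset G.V, ∑ v ∈ X, ∑ e, G.inco e v * h e =
      ∑ e, ((if G.tail e ∈ X then 1 else 0) - (if G.head e ∈ X then 1 else 0)) * h e := by
    intro X
    rw [Finset.sum_comm]
    apply Finset.sum_congr rfl
    intro e _
    rw [← Finset.sum_mul]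
    congr 1
    simp [inco]
  have hcut := G.cut_ncard
  have hy0 : ∀ v, y v = 0 := by
    intro v
    apply le_antisymm
    · by_contra! hv
      set X : Finset G.V := Finset.univ.filter (fun v => 0 < y v) with hX
      have hpos : 0 < ∑ v ∈ X, y v := Finset.sum_pos (fun i hi => by simpa [hX] using hi)
        ⟨v, by simpa [hX] using hv⟩
      have h1 : ∑ v ∈ X, ∑ e, G.inco e v * h e = ((G.cut (X : Set G.V)).ncard : ℝ) := by
        rw [hsum, hcut]
        apply Finset.sum_congr rfl
        intro e _
        by_cases h1 : G.tail e ∈ X <;> by_cases h2 : G.head e ∈ X <;> simp only [h1, h2] <;> simp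
        · apply hup
          simp [hX] at h1 h2; linarith
        · have := hdn e (by simp [hX] at h1 h2; linarith)
          linarith
      simp only [hy, Finset.sum_sub_distrib] at hpos
      have := (abs_le.1 (hω X)).2
      linarith
    · by_contra! hv
      set X : Finset G.V := Finset.univ.filter (fun v => y v < 0) with hX
      have hpos : ∑ v ∈ X, y v < 0 := Finset.sum_neg (fun i hi => by simpa [hX] using hi)
        ⟨v, by simpa [hX] using hv⟩
      have h1 : ∑ v ∈ X, ∑ e, G.inco e v * h e = -((G.cut (X : Set G.V)).ncard : ℝ) := by
        rw [hsum, hcut, ← Finset.sum_neg_distrib]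
        apply Finset.sum_congr rfl
        intro e _
        by_cases h1 : G.tail e ∈ X <;> by_cases h2 : G.head e ∈ X <;> simp only [h1, h2] <;> simp
        · apply hdn
          simp [hX] at h1 h2; linarith
        · apply hup e (by simp [hX] at h1 h2; linarith)
      simp only [hy, Finset.sum_sub_distrib] at hpos
      have := (abs_le.1 (hω X)).1
      linarith
  refine ⟨h, fun e => abs_le.2 (hb e), fun v => ?_⟩
  have := hy0 v
  simp only [hy] at this
  linarith
end Multigraph

namespace Multigraph
open Classical

/-- Local counting at a vertex for small flows. -/
theorem local_count {α : Type} (P N : Finset α) (f : α → ℝ) (t : ℕ) (ht : 2 ≤ t) (ρ : ℝ)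
    (hρ : (2 * (t : ℝ) - 1) * ρ < 2 * t + 1) (hρ1 : 1 ≤ ρ)
    (hcard : P.card + N.card = 2 * t + 1)
    (hP : ∀ e ∈ P, 1 ≤ f e ∧ f e ≤ ρ) (hN : ∀ e ∈ N, 1 ≤ f e ∧ f e ≤ ρ)
    (hs : ∑ e ∈ P, f e = ∑ e ∈ N, f e) :
    P.card ≤ t + 1 := by
  by_contra! hlt
  have h1 : (P.card : ℝ) ≤ ∑ e ∈ P, f e := by
    have := Finset.card_nsmul_le_sum P f 1 (fun e he => (hP e he).1)
    simpa using this
  have h2 : ∑ e ∈ N, f e ≤ N.card * ρ := by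
    have := Finset.sum_le_card_nsmul N f ρ (fun e he => (hN e he).2)
    simpa using this
  have h3 : (t : ℝ) + 2 ≤ P.card := by exact_mod_cast hlt
  have h4 : (P.card : ℝ) + N.card = 2 * t + 1 := by exact_mod_cast hcard
  have h5 : (2 : ℝ) ≤ t := by exact_mod_cast ht
  have h6 : (N.card : ℝ) ≤ t - 1 := by linarith
  have h7 : (N.card : ℝ) * ρ ≤ (t - 1) * ρ := by nlinarith
  nlinarith

theorem local_bounds {α : Type} (P N : Finset α) (f : α → ℝ) (t : ℕ) (ρ : ℝ)
    (hcP : P.card = t + 1) (hcN : N.card = t)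
    (hP : ∀ e ∈ P, 1 ≤ f e ∧ f e ≤ ρ) (hN : ∀ e ∈ N, 1 ≤ f e ∧ f e ≤ ρ)
    (hs : ∑ e ∈ P, f e = ∑ e ∈ N, f e) :
    (∀ e ∈ P, f e ≤ t * (ρ - 1)) ∧ (∀ e ∈ N, (t : ℝ) + 1 - (t - 1) * ρ ≤ f e) := by
  constructor
  · intro e he
    have h1 : (t : ℝ) ≤ ∑ e ∈ P.erase e, f e := by
      have := Finset.card_nsmul_le_sum (P.erase e) f 1
        (fun e he => (hP e (Finset.mem_of_mem_erase he)).1)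
      rw [Finset.card_erase_of_mem he, hcP] at this
      simpa using this
    have h2 : ∑ e ∈ N, f e ≤ t * ρ := by
      have := Finset.sum_le_card_nsmul N f ρ (fun e he => (hN e he).2)
      rw [hcN] at this
      simpa using this
    have h3 := Finset.add_sum_erase P f he
    linarith
  · intro e he
    have h1 : (t : ℝ) + 1 ≤ ∑ e ∈ P, f e := by
      have := Finset.card_nsmul_le_sum P f 1 (fun e he => (hP e he).1)
      rw [hcP] at this
      simpa using this
    have h2 : ∑ e ∈ N.erase e, f e ≤ (t - 1) * ρ := by
      have := Finset.sum_le_card_nsmul (N.erase e) f ρ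
        (fun e he => (hN e (Finset.mem_of_mem_erase he)).2)
      have hc := Finset.card_erase_add_one he
      have hc' : ((N.erase e).card : ℝ) = t - 1 := by
        rw [hcN] at hc
        have : ((N.erase e).card : ℝ) + 1 = t := by exact_mod_cast hc
        linarith
      rw [nsmul_eq_mul, hc'] at this
      exact this
    have h3 := Finset.add_sum_erase N f he
    linarith

theorem bipartite_of_flow (H : Multigraph) (t : ℕ) (ht : 2 ≤ t) (hreg : H.IsRegular (2 * t + 1))
    (r : ℝ) (hr2 : 2 ≤ r) (hr : r < 2 + 2 / (2 * (t : ℝ) - 1)) (hf : H.HasNZFlow r) :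
    H.IsBipartite := by
  obtain ⟨f, hf1, hf2⟩ := hf
  have h5 : (2 : ℝ) ≤ t := by exact_mod_cast ht
  set ρ := r - 1 with hρ
  have hρ1 : 1 ≤ ρ := by linarith
  have hρ2 : (2 * (t : ℝ) - 1) * ρ < 2 * t + 1 := by
    have hp : 0 < 2 * (t : ℝ) - 1 := by linarith
    have h0 : ρ < 1 + 2 / (2 * (t : ℝ) - 1) := by linarith
    have := mul_lt_mul_of_pos_left h0 hp
    have e : (2 * (t : ℝ) - 1) * (1 + 2 / (2 * (t : ℝ) - 1)) = 2 * t + 1 := by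
      field_simp; ring
    linarith
  let P : H.V → Finset H.E := fun v => Finset.univ.filter (fun e => 0 < H.inco e v * f e)
  let N : H.V → Finset H.E := fun v => Finset.univ.filter (fun e => H.inco e v * f e < 0)
  have hf0 : ∀ e, f e ≠ 0 := by
    intro e h0
    have := (hf1 e).1
    rw [h0] at this; norm_num at this
  have hinc : ∀ v e, H.Inc v e → |H.inco e v| = 1 := by
    rintro v e (rfl | rfl)
    · rw [inco_tail]; norm_num
    · rw [inco_head]; norm_num
  have habs : ∀ v e, H.inco e v * f e ≠ 0 → |H.inco e v * f e| = |f e| := by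
    intro v e h
    rw [abs_mul, hinc, one_mul]
    by_contra hn
    exact h (by rw [H.inco_of_not_inc hn, zero_mul])
  have hcard : ∀ v, (P v).card + (N v).card = 2 * t + 1 := by
    intro v
    rw [← hreg v, H.degree_eq_card v, ← Finset.card_union_of_disjoint]
    · congr 1
      ext e
      simp only [P, N, Finset.mem_union, Finset.mem_filter, Finset.mem_univ, true_and]
      constructor
      · intro h
        by_contra hn
        rw [H.inco_of_not_inc hn] at h
        simp at h
      · intro h
        have h1 := hinc v e h
        have : H.inco e v * f e ≠ 0 := mul_ne_zero (fun h0 => by simp [h0] at h1) (hf0 e)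
        exact (lt_or_gt_of_ne this).symm
    · rw [Finset.disjoint_left]
      intro e h1 h2
      simp [P, N] at h1 h2
      linarith
  have hsum : ∀ v, ∑ e ∈ P v, |f e| = ∑ e ∈ N v, |f e| := by
    intro v
    have h := (H.kirchhoff_iff f v).1 (hf2 v)
    have h1 : ∀ e, H.inco e v * f e = (if 0 < H.inco e v * f e then |f e| else 0) -
        (if H.inco e v * f e < 0 then |f e| else 0) := by
      intro e
      rcases lt_trichotomy (H.inco e v * f e) 0 with h | h | h
      · rw [if_neg (by linarith), if_pos h, ← habs v e h.ne, abs_of_neg h]; ring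
      · rw [if_neg (by linarith), if_neg (by linarith), h]; ring
      · rw [if_pos h, if_neg (by linarith), ← habs v e h.ne', abs_of_pos h]; ring
    rw [Finset.sum_congr rfl (fun e _ => h1 e), Finset.sum_sub_distrib,
      ← Finset.sum_filter, ← Finset.sum_filter] at h
    exact sub_eq_zero.1 h
  have hP1 : ∀ v, (P v).card ≤ t + 1 := fun v =>
    local_count (P v) (N v) (fun e => |f e|) t ht ρ hρ2 hρ1 (hcard v)
      (fun e _ => hf1 e) (fun e _ => hf1 e) (hsum v)
  have hN1 : ∀ v, (N v).card ≤ t + 1 := fun v =>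
    local_count (N v) (P v) (fun e => |f e|) t ht ρ hρ2 hρ1 (by rw [add_comm]; exact hcard v)
      (fun e _ => hf1 e) (fun e _ => hf1 e) (hsum v).symm
  have hA : ∀ v, (P v).card = t + 1 → (∀ e ∈ P v, |f e| ≤ t * (ρ - 1)) ∧
      (∀ e ∈ N v, (t : ℝ) + 1 - (t - 1) * ρ ≤ |f e|) := fun v h =>
    local_bounds (P v) (N v) (fun e => |f e|) t ρ h (by have := hcard v; omega)
      (fun e _ => hf1 e) (fun e _ => hf1 e) (hsum v)
  have hA' : ∀ v, ¬ (P v).card = t + 1 → (∀ e ∈ N v, |f e| ≤ t * (ρ - 1)) ∧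
      (∀ e ∈ P v, (t : ℝ) + 1 - (t - 1) * ρ ≤ |f e|) := fun v h =>
    local_bounds (N v) (P v) (fun e => |f e|) t ρ
      (by have := hcard v; have := hP1 v; have := hN1 v; omega)
      (by have := hcard v; have := hP1 v; have := hN1 v; omega)
      (fun e _ => hf1 e) (fun e _ => hf1 e) (hsum v).symm
  have hgap : (t : ℝ) * (ρ - 1) < t + 1 - (t - 1) * ρ := by linarith
  -- each edge is positive at one end and negative at the other
  have hedge : ∀ e, (e ∈ P (H.tail e) ∧ e ∈ N (H.head e)) ∨
      (e ∈ N (H.tail e) ∧ e ∈ P (H.head e)) := by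
    intro e
    simp only [P, N, Finset.mem_filter, Finset.mem_univ, true_and, inco_tail, inco_head]
    rcases lt_or_gt_of_ne (hf0 e) with h | h
    · right; constructor <;> linarith
    · left; constructor <;> linarith
  refine ⟨{v | (P v).card = t + 1}, ?_⟩
  intro e hiff
  simp only [Set.mem_ofPred_eq] at hiff
  by_cases h1 : (P (H.tail e)).card = t + 1
  · have h2 := hiff.1 h1
    rcases hedge e with ⟨h3, h4⟩ | ⟨h3, h4⟩
    · have := (hA _ h1).1 e h3; have := (hA _ h2).2 e h4; linarith
    · have := (hA _ h1).2 e h3; have := (hA _ h2).1 e h4; linarith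
  · have h2 : ¬ (P (H.head e)).card = t + 1 := fun h => h1 (hiff.2 h)
    rcases hedge e with ⟨h3, h4⟩ | ⟨h3, h4⟩
    · have := (hA' _ h1).2 e h3; have := (hA' _ h2).1 e h4; linarith
    · have := (hA' _ h1).1 e h3; have := (hA' _ h2).2 e h4; linarith

theorem flowNumber_ge (H : Multigraph) (t : ℕ) (ht : 2 ≤ t) (hreg : H.IsRegular (2 * t + 1))
    (h1 : H.IsClass1)
    (hno : ¬ ∃ N : Set H.E, H.IsPerfectMatching N ∧ (H.deleteEdges N).IsBipartite) :
    ((2 + 2 / (2 * (t : ℝ) - 1) : ℝ) : EReal) ≤ H.flowNumber := by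
  unfold flowNumber
  apply le_sInf
  rintro x ⟨r, rfl, hr2, hf⟩
  rw [EReal.coe_le_coe_iff]
  by_contra! hlt
  obtain ⟨s, hs⟩ := H.bipartite_of_flow t ht hreg r hr2 hlt hf
  apply hno
  by_cases hV : IsEmpty H.V
  · exact ⟨∅, fun v => hV.elim v, s, fun e => hV.elim (H.tail e.1)⟩
  · rw [not_isEmpty_iff] at hV
    obtain ⟨v⟩ := hV
    obtain ⟨N, hN⟩ := H.exists_perfectMatching (by omega) hreg v h1
    exact ⟨N, hN, s, fun e => hs e.1⟩

/-- The two non-matching edges at a vertex of a cubic graph. -/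
theorem card_nonmatching (G : Multigraph) (hG : G.IsRegular 3) (N : Set G.E)
    (hN : G.IsPerfectMatching N) (v : G.V) :
    (Finset.univ.filter (fun e => G.Inc v e ∧ e ∉ N)).card = 2 := by
  obtain ⟨n, ⟨hn1, hn2⟩, hn3⟩ := hN v
  have : Finset.univ.filter (fun e => G.Inc v e ∧ e ∉ N) =
      (Finset.univ.filter (fun e => G.Inc v e)).erase n := by
    ext e
    simp only [Finset.mem_filter, Finset.mem_univ, true_and, Finset.mem_erase]
    constructor
    · rintro ⟨h1, h2⟩
      exact ⟨fun h => h2 (h ▸ hn1), h1⟩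
    · rintro ⟨h1, h2⟩
      exact ⟨h2, fun h => h1 (hn3 e ⟨h, h2⟩)⟩
  rw [this, Finset.card_erase_of_mem (by simpa using hn2), ← G.degree_eq_card, hG v]

/-- Cyclic orientation of the 2-factor complementary to a perfect matching. -/
theorem exists_orient (G : Multigraph) (hG : G.IsRegular 3) (N : Set G.E)
    (hN : G.IsPerfectMatching N) :
    ∃ g : G.V → G.E, Function.Injective g ∧ (∀ v, G.Inc v (g v) ∧ g v ∉ N) ∧
      ∀ e, e ∉ N → (g (G.tail e) = e ∨ g (G.head e) = e) := by
  let T : G.V → Finset G.E := fun v => Finset.univ.filter (fun e => G.Inc v e ∧ e ∉ N)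
  have hT : ∀ v, (T v).card = 2 := G.card_nonmatching hG N hN
  have hends : ∀ (X : Finset G.V) e, (X.filter (fun v => e ∈ T v)).card ≤ 2 := by
    intro X e
    have : X.filter (fun v => e ∈ T v) ⊆ {G.tail e, G.head e} := by
      intro v hv
      have hv1 := (Finset.mem_filter.1 (Finset.mem_filter.1 hv).2).2.1
      simp only [Finset.mem_insert, Finset.mem_singleton]
      exact hv1.imp Eq.symm Eq.symm
    exact (Finset.card_le_card this).trans Finset.card_le_two
  have hall : ∀ X : Finset G.V, X.card ≤ (X.biUnion T).card := by
    intro X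
    have h := Finset.sum_card_bipartiteAbove_eq_sum_card_bipartiteBelow
      (s := X) (t := X.biUnion T) (fun v e => e ∈ T v)
    have h1 : ∀ v ∈ X, (Finset.bipartiteAbove (fun v e => e ∈ T v) (X.biUnion T) v).card = 2 := by
      intro v hv
      rw [← hT v]
      congr 1
      ext e
      simp only [Finset.bipartiteAbove, Finset.mem_filter, Finset.mem_biUnion]
      exact ⟨fun h => h.2, fun h => ⟨⟨v, hv, h⟩, h⟩⟩
    rw [Finset.sum_congr rfl h1] at h
    have h2 : ∑ e ∈ X.biUnion T, (Finset.bipartiteBelow (fun v e => e ∈ T v) X e).card ≤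
        ∑ e ∈ X.biUnion T, 2 := Finset.sum_le_sum (fun e _ => hends X e)
    simp at h h2
    omega
  obtain ⟨g, hinj, hg⟩ := (Finset.all_card_le_biUnion_card_iff_exists_injective T).1 hall
  have hg' : ∀ v, G.Inc v (g v) ∧ g v ∉ N := by
    intro v
    simpa [T] using hg v
  refine ⟨g, hinj, hg', ?_⟩
  have himg : Finset.univ.image g = Finset.univ.filter (fun e => e ∉ N) := by
    apply Finset.eq_of_subset_of_card_le
    · intro e he
      obtain ⟨v, _, rfl⟩ := Finset.mem_image.1 he
      simpa using (hg' v).2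
    · rw [Finset.card_image_of_injective _ hinj]
      have h := Finset.sum_card_bipartiteAbove_eq_sum_card_bipartiteBelow
        (s := (Finset.univ : Finset G.V)) (t := Finset.univ.filter (fun e => e ∉ N))
        (fun v e => e ∈ T v)
      have h1 : ∀ v ∈ (Finset.univ : Finset G.V), (Finset.bipartiteAbove (fun v e => e ∈ T v)
          (Finset.univ.filter (fun e => e ∉ N)) v).card = 2 := by
        intro v hv
        rw [← hT v]
        congr 1
        ext e
        simp [Finset.bipartiteAbove, T]
      have h2 : ∀ e ∈ Finset.univ.filter (fun e => e ∉ N),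
          (Finset.bipartiteBelow (fun v e => e ∈ T v) (Finset.univ : Finset G.V) e).card = 2 := by
        intro e he
        have : Finset.bipartiteBelow (fun v e => e ∈ T v) (Finset.univ : Finset G.V) e =
            {G.tail e, G.head e} := by
          ext v
          simp at he
          simp [Finset.bipartiteBelow, T, he, Inc, eq_comm]
        rw [this, Finset.card_pair (G.tail_ne_head e)]
      rw [Finset.sum_congr rfl h1, Finset.sum_congr rfl h2] at h
      simp at h ⊢
      omega
  intro e he
  have : e ∈ Finset.univ.image g := by rw [himg]; simpa using he
  obtain ⟨v, _, hv⟩ := Finset.mem_image.1 this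
  have hi := (hg' v).1
  rw [hv] at hi
  rcases hi with h | h
  · left; rw [h]; exact hv
  · right; rw [h]; exact hv

theorem isClass1_of_bipartite_factor (G : Multigraph) (hG : G.IsRegular 3) (N : Set G.E)
    (hN : G.IsPerfectMatching N) (s : Set G.V)
    (hs : ∀ e, e ∉ N → ¬ (G.tail e ∈ s ↔ G.head e ∈ s)) : G.IsClass1 := by
  by_cases hV : IsEmpty G.V
  · exact G.isClass1_of_isEmpty hV
  rw [not_isEmpty_iff] at hV
  obtain ⟨v₀⟩ := hV
  obtain ⟨g, hinj, hg, hor⟩ := G.exists_orient hG N hN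
  have hnot : ∀ e, ¬ (g (G.tail e) = e ∧ g (G.head e) = e) := by
    rintro e ⟨h1, h2⟩
    exact G.tail_ne_head e (hinj (h1.trans h2.symm))
  have key : ∀ v e, e ∉ N → G.Inc v e →
      ((g (G.tail e) = e ↔ G.tail e ∈ s) ↔ (g v = e ↔ v ∈ s)) := by
    rintro v e he (rfl | rfl)
    · rfl
    · have h1 := hnot e
      have h2 := hor e he
      have h3 := hs e he
      tauto
  apply G.isClass1_of_coloring hG v₀
    (fun e => if e ∈ N then 0 else if (g (G.tail e) = e ↔ G.tail e ∈ s) then 1 else 2)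
  rintro e e' ⟨hne, v, hi, hi'⟩ heq
  by_cases h1 : e ∈ N
  · by_cases h2 : e' ∈ N
    · exact hne ((hN v).unique ⟨h1, hi⟩ ⟨h2, hi'⟩)
    · simp only [h1, h2, if_true, if_false] at heq
      split_ifs at heq <;> simp at heq
  · by_cases h2 : e' ∈ N
    · simp only [h1, h2, if_true, if_false] at heq
      split_ifs at heq <;> simp at heq
    · have hiff : (g v = e ↔ v ∈ s) ↔ (g v = e' ↔ v ∈ s) := by
        rw [← key v e h1 hi, ← key v e' h2 hi']
        simp only [h1, h2, if_false] at heq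
        split_ifs at heq with h3 h4 h4
        · exact iff_of_true h3 h4
        · simp at heq
        · simp at heq
        · exact iff_of_false h3 h4
      have h3 : g v ≠ e ∧ g v ≠ e' := by
        constructor
        · intro h
          have : g v ≠ e' := fun h' => hne (h.symm.trans h')
          tauto
        · intro h
          have : g v ≠ e := fun h' => hne (h'.symm.trans h)
          tauto
      have hsub : ({e, e', g v} : Finset G.E) ⊆
          Finset.univ.filter (fun e => G.Inc v e ∧ e ∉ N) := by
        intro x hx
        simp only [Finset.mem_insert, Finset.mem_singleton] at hx
        rcases hx with rfl | rfl | rfl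
        · simp [hi, h1]
        · simp [hi', h2]
        · simpa using hg v
      have hle := Finset.card_le_card hsub
      rw [G.card_nonmatching hG N hN v, Finset.card_eq_three.2
        ⟨e, e', g v, hne, h3.1.symm, h3.2.symm, rfl⟩] at hle
      omega

end Multigraph

namespace Multigraph
open Classical

/-- An original edge, as an edge of `G + kM`. -/
def inlE (G : Multigraph) (M : Set G.E) (k : ℕ) (e : G.E) : (G.addCopies M k).E := Sum.inl e

/-- A copied edge, as an edge of `G + kM`. -/
def inrE (G : Multigraph) (M : Set G.E) (k : ℕ) (i : Fin k) (m : M) : (G.addCopies M k).E :=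
  Sum.inr ⟨i, m⟩

/-- Functions on the edges of `G + kM` by cases. -/
def elimE (G : Multigraph) (M : Set G.E) (k : ℕ) (a : G.E → ℝ) (b : Fin k → G.E → ℝ) :
    (G.addCopies M k).E → ℝ := fun x => Sum.elim a (fun q => b q.1 q.2.1) x

theorem sum_addCopies {A : Type} [AddCommMonoid A] (G : Multigraph) (M : Set G.E) (k : ℕ)
    (F : (G.addCopies M k).E → A) :
    ∑ x, F x = ∑ e : G.E, F (G.inlE M k e) + ∑ i : Fin k, ∑ m : M, F (G.inrE M k i m) := by
  let u : (G.E ⊕ ((_ : Fin k) × ↥M)) ≃ (G.addCopies M k).E := Equiv.refl _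
  rw [← Equiv.sum_comp u, Fintype.sum_sum_type, Fintype.sum_sigma]
  rfl

theorem sum_matching {A : Type} [AddCommMonoid A] (G : Multigraph) (M : Set G.E) (v : G.V)
    (n : G.E) (hn : n ∈ M ∧ G.Inc v n) (hu : ∀ e, e ∈ M ∧ G.Inc v e → e = n)
    (F : G.E → A) (hF : ∀ e, ¬ G.Inc v e → F e = 0) :
    ∑ m : M, F m = F n := by
  rw [Fintype.sum_eq_single (⟨n, hn.1⟩ : M)]
  intro m hm
  apply hF
  intro hi
  exact hm (Subtype.ext (hu m.1 ⟨m.2, hi⟩))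

theorem addCopies_regular (G : Multigraph) (hG : G.IsRegular 3) (M : Set G.E)
    (hM : G.IsPerfectMatching M) (k : ℕ) : (G.addCopies M k).IsRegular (3 + k) := by
  intro v
  obtain ⟨n, hn, hu⟩ := hM v
  rw [degree_eq_card, Finset.card_filter, sum_addCopies]
  have h1 : ∑ e : G.E, (if (G.addCopies M k).Inc v (G.inlE M k e) then 1 else 0) = 3 := by
    have := G.degree_eq_card v
    rw [hG v, Finset.card_filter] at this
    exact this.symm
  have h2 : ∀ i : Fin k, ∑ m : M, (if (G.addCopies M k).Inc v (G.inrE M k i m) then 1 else 0) = 1 := by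
    intro i
    have := G.sum_matching M v n hn hu (fun e => if G.Inc v e then 1 else 0)
      (fun e he => if_neg he)
    simp only [hn.2, if_true] at this
    exact this
  rw [h1, Finset.sum_congr rfl (fun i _ => h2 i)]
  simp

theorem addCopies_no_matching (G : Multigraph) (hG : G.IsRegular 3) (hc : G.IsClass2)
    (M : Set G.E) (k : ℕ) :
    ¬ ∃ N : Set (G.addCopies M k).E, (G.addCopies M k).IsPerfectMatching N ∧
      ((G.addCopies M k).deleteEdges N).IsBipartite := by
  rintro ⟨N, hN, s, hs⟩
  apply hc
  let p : (G.addCopies M k).E → G.E := Sum.elim id (fun q => q.2.1)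
  have hp : ∀ v x, (G.addCopies M k).Inc v x ↔ G.Inc v (p x) := by
    rintro v (e | ⟨i, e⟩) <;> rfl
  refine G.isClass1_of_bipartite_factor hG (p '' N) ?_ s ?_
  · intro v
    obtain ⟨n, ⟨hn1, hn2⟩, hu⟩ := hN v
    refine ⟨p n, ⟨⟨n, hn1, rfl⟩, (hp v n).1 hn2⟩, ?_⟩
    rintro e ⟨⟨x, hx, rfl⟩, hi⟩
    rw [hu x ⟨hx, (hp v x).2 hi⟩]
  · intro e he
    exact hs ⟨Sum.inl e, fun h => he ⟨_, h, rfl⟩⟩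

theorem abs_combo (R d h : ℝ) (hR : 2 ≤ R) (hd : d = 1 ∨ d = -1) (hh : |h| ≤ 1) :
    1 ≤ |R / 2 * d + (R - 2) / 2 * h| ∧ |R / 2 * d + (R - 2) / 2 * h| ≤ R - 1 := by
  have h1 := abs_le.1 hh
  rcases hd with rfl | rfl
  · rw [abs_of_nonneg (by nlinarith)]
    constructor <;> nlinarith
  · rw [abs_of_nonpos (by nlinarith)]
    constructor <;> nlinarith

theorem addCopies_flow (G : Multigraph) (hG : G.IsRegular 3) (M : Set G.E)
    (hM : G.IsPerfectMatching M) (B W : Set G.V) (r : ℝ) (hr : r ∈ Set.Ioo (4 : ℝ) 5)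
    (hbip : G.IsRBipartition r B W)
    (hpair : ∀ e ∈ M, (G.tail e ∈ B ∧ G.head e ∈ W) ∨ (G.tail e ∈ W ∧ G.head e ∈ B))
    (t : ℕ) (ht : 2 ≤ t) :
    (G.addCopies M (2 * t - 2)).HasNZFlow (2 + 2 / (r / (r - 2) + 2 * t - 3)) := by
  obtain ⟨hU, hI, hX⟩ := hbip
  have ht' : (2 : ℝ) ≤ t := by exact_mod_cast ht
  have hr4 : 4 < r := hr.1
  set c := r / (r - 2) with hc
  have hc0 : 0 < c := by apply div_pos <;> linarith
  have hd0 : 0 < c + 2 * t - 3 := by linarith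
  set R := 2 + 2 / (c + 2 * t - 3) with hR
  have hR2 : 2 ≤ R := by
    have : 0 < 2 / (c + 2 * (t : ℝ) - 3) := by positivity
    linarith
  have hRc : (R - 2) * (c + 2 * t - 3) = 2 := by
    rw [hR]; field_simp; ring
  have hWB : ∀ v, v ∈ W ↔ v ∉ B := by
    intro v
    constructor
    · intro h1 h2
      have : v ∈ B ∩ W := ⟨h2, h1⟩
      rw [hI] at this; exact this
    · intro h
      have : v ∈ B ∪ W := by rw [hU]; trivial
      exact this.resolve_left h
  -- the sign of a vertex
  let σ : G.V → ℝ := fun v => if v ∈ B then 1 else -1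
  have hσ : ∀ v, σ v = 1 ∨ σ v = -1 := by
    intro v; by_cases h : v ∈ B <;> simp [σ, h]
  obtain ⟨h, hh1, hh2⟩ := G.exists_div (fun v => -c * σ v) (by
    intro X
    have h1 : ∑ v ∈ X, -c * σ v = -c * (((X : Set G.V) ∩ B).ncard - ((X : Set G.V) ∩ W).ncard) := by
      rw [← Finset.mul_sum]
      congr 1
      have e1 : (X : Set G.V) ∩ B = (X.filter (fun v => v ∈ B) : Finset G.V) := by
        ext v; simp
      have e2 : (X : Set G.V) ∩ W = (X.filter (fun v => v ∉ B) : Finset G.V) := by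
        ext v; simp [hWB]
      rw [e1, e2, Set.ncard_coe_finset, Set.ncard_coe_finset, Finset.card_filter,
        Finset.card_filter]
      push_cast
      rw [← Finset.sum_sub_distrib]
      apply Finset.sum_congr rfl
      intro v _
      by_cases hv : v ∈ B <;> simp [σ, hv]
    rw [h1, abs_mul, abs_neg, abs_of_pos hc0]
    exact hX X)
  obtain ⟨g, hinj, hg, hor⟩ := G.exists_orient hG M hM
  let ε : G.E → ℝ := fun e => σ (G.tail e)
  have hε : ∀ e ∈ M, ∀ v, G.Inc v e → G.inco e v * ε e = σ v := by
    rintro e he v (rfl | rfl)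
    · rw [inco_tail]; simp [ε]
    · rw [inco_head]
      rcases hpair e he with ⟨h1, h2⟩ | ⟨h1, h2⟩
      · rw [hWB] at h2; simp [ε, σ, h1, h2]
      · rw [hWB] at h1; simp [ε, σ, h1, h2]
  let D : G.E → ℝ := fun e => if e ∈ M then ε e else if g (G.tail e) = e then 1 else -1
  have hD : ∀ e, D e = 1 ∨ D e = -1 := by
    intro e
    simp only [D]
    split_ifs
    · exact hσ _
    · left; rfl
    · right; rfl
  have hDinc : ∀ e, e ∉ M → ∀ v, G.Inc v e → G.inco e v * D e = if g v = e then 1 else -1 := by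
    rintro e he v (rfl | rfl)
    · rw [inco_tail]; simp [D, he]
    · rw [inco_head]
      have h1 : ¬ (g (G.tail e) = e ∧ g (G.head e) = e) := by
        rintro ⟨h1, h2⟩
        exact G.tail_ne_head e (hinj (h1.trans h2.symm))
      rcases hor e he with h2 | h2
      · have h3 : ¬ g (G.head e) = e := fun h3 => h1 ⟨h2, h3⟩
        simp [D, he, h2, h3]
      · have h3 : ¬ g (G.tail e) = e := fun h3 => h1 ⟨h3, h2⟩
        simp [D, he, h2, h3]
  have hDdiv : ∀ v, ∑ e, G.inco e v * D e = σ v := by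
    intro v
    obtain ⟨n, hn, hu⟩ := hM v
    have hterm : ∀ e, G.inco e v * D e = (if e = n then σ v else 0) +
        (2 * (if g v = e then 1 else 0) - (if G.Inc v e ∧ e ∉ M then 1 else 0)) := by
      intro e
      by_cases hi : G.Inc v e
      · by_cases he : e ∈ M
        · have hen := hu e ⟨he, hi⟩
          have hgv : g v ≠ e := fun h => (hg v).2 (h ▸ he)
          have : D e = ε e := by simp [D, he]
          rw [this, hε e he v hi]
          simp [hen, hn.1]
          intro h; exact absurd (h.trans hen.symm) hgv
        · have hen : e ≠ n := fun h => he (h ▸ hn.1)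
          rw [hDinc e he v hi]
          by_cases hge : g v = e
          · simp only [hge, hen, hi, he, if_true, if_false]; norm_num
          · simp only [hge, hen, hi, he, if_true, if_false]; norm_num
      · have hen : e ≠ n := fun h => hi (h ▸ hn.2)
        have hgv : g v ≠ e := fun h => hi (h ▸ (hg v).1)
        rw [G.inco_of_not_inc hi]
        simp [hen, hgv, hi]
    have hcard := G.card_nonmatching hG M hM v
    rw [Finset.card_filter] at hcard
    have hcard' : ∑ e, (if G.Inc v e ∧ e ∉ M then (1 : ℝ) else 0) = 2 := by
      have := congrArg (Nat.cast : ℕ → ℝ) hcard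
      push_cast at this
      exact this
    rw [Finset.sum_congr rfl (fun e _ => hterm e), Finset.sum_add_distrib,
      Finset.sum_sub_distrib, hcard', ← Finset.mul_sum]
    simp
  -- alternating signs on the copies
  let τ : ℕ → ℝ := fun i => (-1) ^ i
  have hτ : ∀ i, τ i = 1 ∨ τ i = -1 := fun i => neg_one_pow_eq_or ℝ i
  have hτsum : ∑ i : Fin (2 * t - 2), τ i = 0 := by
    rw [Fin.sum_univ_eq_sum_range]
    simp only [τ]
    rw [neg_one_geom_sum, if_pos]
    exact ⟨t - 1, by omega⟩
  let f : (G.addCopies M (2 * t - 2)).E → ℝ := G.elimE M (2 * t - 2)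
    (fun e => R / 2 * D e + (R - 2) / 2 * h e)
    (fun i e => R / 2 * (τ i * ε e) + (R - 2) / 2 * (-ε e))
  refine ⟨f, ?_, ?_⟩
  · rintro (e | ⟨i, e⟩)
    · exact abs_combo R (D e) (h e) hR2 (hD e) (hh1 e)
    · refine abs_combo R (τ i * ε e.1) (-ε e.1) hR2 ?_ ?_
      · rcases hτ i with h1 | h1 <;> rcases hσ (G.tail e.1) with h2 | h2 <;>
          simp [ε, h1, h2]
      · rcases hσ (G.tail e.1) with h2 | h2 <;> simp [ε, h2]
  · intro v
    rw [kirchhoff_iff, sum_addCopies]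
    have h1 : ∑ e : G.E, (G.addCopies M (2 * t - 2)).inco (G.inlE M (2 * t - 2) e) v * f (G.inlE M (2 * t - 2) e) =
        R / 2 * σ v + (R - 2) / 2 * (-c * σ v) := by
      rw [← hh2 v, ← hDdiv v, Finset.mul_sum, Finset.mul_sum, ← Finset.sum_add_distrib]
      apply Finset.sum_congr rfl
      intro e _
      change G.inco e v * (R / 2 * D e + (R - 2) / 2 * h e) = _
      ring
    have h2 : ∀ i : Fin (2 * t - 2), ∑ m : M, (G.addCopies M (2 * t - 2)).inco (G.inrE M (2 * t - 2) i m) v *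
        f (G.inrE M (2 * t - 2) i m) = R / 2 * σ v * τ i - (R - 2) / 2 * σ v := by
      intro i
      obtain ⟨n, hn, hu⟩ := hM v
      have := G.sum_matching M v n hn hu
        (fun e => G.inco e v * (R / 2 * (τ i * ε e) + (R - 2) / 2 * (-ε e)))
        (fun e he => by simp only [G.inco_of_not_inc he, zero_mul])
      refine Eq.trans this ?_
      rw [← hε n hn.1 v hn.2]
      ring
    rw [h1, Finset.sum_congr rfl (fun i _ => h2 i), Finset.sum_sub_distrib, ← Finset.mul_sum, hτsum]
    simp only [Finset.sum_const, Finset.card_univ, Fintype.card_fin, nsmul_eq_mul]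
    have hk : ((2 * t - 2 : ℕ) : ℝ) = 2 * t - 2 := by
      rw [Nat.cast_sub (by omega)]; push_cast; ring
    rw [hk]
    linear_combination (-σ v / 2) * hRc

end Multigraph

/-- if there is a family of bridgeless cubic class 2 graphs `G n`
with `r n`-bipartitions (`r n ∈ (4,5)`, `r n → 4`) and perfect matchings `M n`
having the `M n`-class-1 property and pairing the two color classes, then for
every `t ≥ 2` the infimum of the circular flow numbers of `(2t+1)`-regular
class 1 multigraphs having no perfect matching whose removal leaves a bipartite
graph is `2 + 2/(2t-1)`. -/
theorem statement_9 (G : ℕ → Multigraph) (r : ℕ → ℝ)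
    (B W : (n : ℕ) → Set (G n).V) (M : (n : ℕ) → Set (G n).E)
    (hbl : ∀ n, (G n).Bridgeless) (hcubic : ∀ n, (G n).IsRegular 3)
    (hclass2 : ∀ n, (G n).IsClass2)
    (hr : ∀ n, r n ∈ Set.Ioo (4 : ℝ) 5)
    (hbip : ∀ n, (G n).IsRBipartition (r n) (B n) (W n))
    (hM : ∀ n, (G n).IsPerfectMatching (M n))
    (hMc : ∀ n, (G n).MClass1Property (M n))
    (hpair : ∀ n, ∀ e ∈ M n,
      ((G n).tail e ∈ B n ∧ (G n).head e ∈ W n) ∨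
      ((G n).tail e ∈ W n ∧ (G n).head e ∈ B n))
    (hlim : Filter.Tendsto r Filter.atTop (nhds 4)) :
    ∀ t : ℕ, 2 ≤ t →
      sInf {x : EReal | ∃ H : Multigraph,
          H.IsRegular (2 * t + 1) ∧ H.IsClass1 ∧
          (¬ ∃ N : Set H.E, H.IsPerfectMatching N ∧ (H.deleteEdges N).IsBipartite) ∧
          H.flowNumber = x}
        = ((2 + 2 / (2 * (t : ℝ) - 1) : ℝ) : EReal) := by
  intro t ht
  have ht' : (2 : ℝ) ≤ t := by exact_mod_cast ht
  apply le_antisymm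
  · have hle : ∀ n, sInf {x : EReal | ∃ H : Multigraph,
          H.IsRegular (2 * t + 1) ∧ H.IsClass1 ∧
          (¬ ∃ N : Set H.E, H.IsPerfectMatching N ∧ (H.deleteEdges N).IsBipartite) ∧
          H.flowNumber = x} ≤ ((2 + 2 / (r n / (r n - 2) + 2 * t - 3) : ℝ) : EReal) := by
      intro n
      have hreg : ((G n).addCopies (M n) (2 * t - 2)).IsRegular (2 * t + 1) := by
        have := (G n).addCopies_regular (hcubic n) (M n) (hM n) (2 * t - 2)
        rwa [show 3 + (2 * t - 2) = 2 * t + 1 by omega] at this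
      refine le_trans (sInf_le ⟨(G n).addCopies (M n) (2 * t - 2), hreg, hMc n t ht,
        (G n).addCopies_no_matching (hcubic n) (hclass2 n) (M n) _, rfl⟩) ?_
      apply sInf_le
      refine ⟨_, rfl, ?_, (G n).addCopies_flow (hcubic n) (M n) (hM n) (B n) (W n) (r n) (hr n)
        (hbip n) (hpair n) t ht⟩
      have h4 : 4 < r n := (hr n).1
      have hc0 : 0 < r n / (r n - 2) := by apply div_pos <;> linarith
      have : 0 < 2 / (r n / (r n - 2) + 2 * (t : ℝ) - 3) := by
        apply div_pos <;> linarith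
      linarith
    have hlim2 : Filter.Tendsto (fun n => 2 + 2 / (r n / (r n - 2) + 2 * (t : ℝ) - 3))
        Filter.atTop (nhds (2 + 2 / ((4 : ℝ) / (4 - 2) + 2 * (t : ℝ) - 3))) := by
      refine Filter.Tendsto.const_add _ (Filter.Tendsto.div tendsto_const_nhds ?_ ?_)
      · refine Filter.Tendsto.sub_const (Filter.Tendsto.add_const _ ?_) _
        exact Filter.Tendsto.div hlim (hlim.sub_const 2) (by norm_num)
      · have : (4 : ℝ) / (4 - 2) + 2 * (t : ℝ) - 3 = 2 * t - 1 := by norm_num; ring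
        rw [this]
        linarith
    rw [show (4 : ℝ) / (4 - 2) + 2 * (t : ℝ) - 3 = 2 * t - 1 by norm_num; ring] at hlim2
    exact ge_of_tendsto' ((continuous_coe_real_ereal.tendsto _).comp hlim2) hle
  · apply le_sInf
    rintro x ⟨H, hreg, h1, hno, rfl⟩
    exact H.flowNumber_ge t ht hreg h1 hno
end

section
/- For every integer n ≥ 1, the Flower snark J_{2n+1} has a (4 + 1/n)-bipartition (B_n, W_n) and a perfect matching M_n (one may take M_n = {a_i b_i, c_{i+1} d_i : i ∈ ℤ_{2n+1}}) such that J_{2n+1} has the M_n-class-1 property and every edge of M_n has one end in B_n and the other in W_n. -/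
/-- The Flower snark `J_{2n+1}` (for `n ≥ 1`): vertices `(i, 0) = a_i`,
`(i, 1) = b_i`, `(i, 2) = c_i`, `(i, 3) = d_i` for `i ∈ ℤ_{2n+1}`, and for each
`i` the six edges `b_i a_i`, `b_i c_i`, `b_i d_i`, `a_i a_{i+1}`, `c_i d_{i+1}`,
`c_{i+1} d_i` (indexed by `(i, j)`, `j ∈ Fin 6`, in this order). -/
noncomputable def flowerSnark (n : ℕ) (hn : 1 ≤ n) : Multigraph where
  V := ZMod (2 * n + 1) × Fin 4
  E := ZMod (2 * n + 1) × Fin 6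
  vFinite := by
    haveI : NeZero (2 * n + 1) := ⟨Nat.succ_ne_zero _⟩
    infer_instance
  eFinite := by
    haveI : NeZero (2 * n + 1) := ⟨Nat.succ_ne_zero _⟩
    infer_instance
  ends := fun e =>
    if e.2 = 0 then ((e.1, 1), (e.1, 0))           -- b_i a_i
    else if e.2 = 1 then ((e.1, 1), (e.1, 2))      -- b_i c_i
    else if e.2 = 2 then ((e.1, 1), (e.1, 3))      -- b_i d_i
    else if e.2 = 3 then ((e.1, 0), (e.1 + 1, 0))  -- a_i a_{i+1}
    else if e.2 = 4 then ((e.1, 2), (e.1 + 1, 3))  -- c_i d_{i+1}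
    else ((e.1 + 1, 2), (e.1, 3))                  -- c_{i+1} d_i
  no_loop := by
    haveI : Fact (1 < 2 * n + 1) := ⟨by omega⟩
    rintro ⟨i, j⟩
    fin_cases j <;> simp [Prod.ext_iff]

namespace FlowerAux

lemma val_succ (n : ℕ) (hn : 1 ≤ n) (i : ZMod (2 * n + 1)) :
    ((i + 1).val = 0 ∧ i.val = 2 * n) ∨ ((i + 1).val = i.val + 1 ∧ i.val < 2 * n) := by
  haveI : Fact (1 < 2 * n + 1) := ⟨by omega⟩
  have h1 := ZMod.val_lt i
  rw [ZMod.val_add, ZMod.val_one]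
  by_cases h : i.val = 2 * n
  · left; simp [h]
  · right
    rw [Nat.mod_eq_of_lt (by omega)]
    omega

/-- the auxiliary integer flow (as a function of the index and of the edge type) -/
def hF (n k : ℕ) (j : Fin 6) : ℤ :=
  if k % 2 = 0 then
    (![-(2 * (n : ℤ) + 1), -1, 1 - 2 * (n : ℤ), 2 * (n : ℤ) - (k : ℤ), -(2 * (n : ℤ) + 1),
      -1 - (k : ℤ)] : Fin 6 → ℤ) j
  else
    (![2 * (n : ℤ) - 1, 2 * (n : ℤ) + 1, 1, -((k : ℤ) + 1), (k : ℤ) - 2 * (n : ℤ),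
      -(2 * (n : ℤ) + 1)] : Fin 6 → ℤ) j

/-- the sign of a vertex -/
def eps (k : ℕ) (v : Fin 4) : ℤ :=
  if k % 2 = 0 then ![1, -1, -1, 1] v else ![-1, 1, -1, 1] v

lemma hF_bound (n k : ℕ) (hk : k ≤ 2 * n) (j : Fin 6) : |hF n k j| ≤ 2 * n + 1 := by
  unfold hF
  rw [abs_le]
  split_ifs with h <;> fin_cases j <;> simp <;> omega

lemma eps_cases (k : ℕ) (v : Fin 4) : eps k v = 1 ∨ eps k v = -1 := by
  unfold eps
  split_ifs <;> fin_cases v <;> simp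

/-- tails of the edges -/
def tl {n : ℕ} (e : ZMod (2 * n + 1) × Fin 6) : ZMod (2 * n + 1) × Fin 4 :=
  (e.1 + ![0, 0, 0, 0, 0, 1] e.2, ![1, 1, 1, 0, 2, 2] e.2)

/-- heads of the edges -/
def hd {n : ℕ} (e : ZMod (2 * n + 1) × Fin 6) : ZMod (2 * n + 1) × Fin 4 :=
  (e.1 + ![0, 0, 0, 1, 1, 0] e.2, ![0, 2, 3, 0, 3, 3] e.2)

lemma tail_eq (n : ℕ) (hn : 1 ≤ n) (e : ZMod (2 * n + 1) × Fin 6) :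
    (flowerSnark n hn).tail e = tl e := by
  obtain ⟨i, j⟩ := e
  fin_cases j <;> simp [Multigraph.tail, flowerSnark, tl]

lemma head_eq (n : ℕ) (hn : 1 ≤ n) (e : ZMod (2 * n + 1) × Fin 6) :
    (flowerSnark n hn).head e = hd e := by
  obtain ⟨i, j⟩ := e
  fin_cases j <;> simp [Multigraph.head, flowerSnark, hd]

lemma inc_iff (n : ℕ) (hn : 1 ≤ n) (e : ZMod (2 * n + 1) × Fin 6)
    (w : ZMod (2 * n + 1) × Fin 4) :
    (flowerSnark n hn).Inc w e ↔ (tl e = w ∨ hd e = w) := by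
  rw [← tail_eq n hn e, ← head_eq n hn e]
  exact Iff.rfl

lemma sum_identity (n : ℕ) (hn : 1 ≤ n) (y : ZMod (2 * n + 1) × Fin 4 → ℤ) :
    ∑ e : ZMod (2 * n + 1) × Fin 6, hF n e.1.val e.2 * (y (tl e) - y (hd e)) =
      (4 * n + 1) * ∑ v : ZMod (2 * n + 1) × Fin 4, eps v.1.val v.2 * y v := by
  rw [Finset.mul_sum, Fintype.sum_prod_type, Fintype.sum_prod_type]
  let D : ZMod (2 * n + 1) → ℤ := fun i =>
    hF n (i - 1).val 3 * y (i, 0) + hF n (i - 1).val 4 * y (i, 3)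
      - hF n (i - 1).val 5 * y (i, 2)
  have hD : ∑ i, D (i + 1) = ∑ i, D i := Equiv.sum_comp (Equiv.addRight (1 : ZMod (2 * n + 1))) D
  rw [← sub_eq_zero, ← Finset.sum_sub_distrib]
  rw [← sub_eq_zero, ← Finset.sum_sub_distrib] at hD
  rw [← neg_eq_zero, ← Finset.sum_neg_distrib] at hD
  rw [← hD]
  refine Finset.sum_congr rfl fun i _ => ?_
  have hv := val_succ n hn (i - 1)
  rw [sub_add_cancel] at hv
  have e3 : ((i.val : ℕ) % 2 = 0 → hF n (i - 1).val 3 = - i.val ∧ hF n (i - 1).val 4 = -(2 * n + 1)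
        + i.val ∧ hF n (i - 1).val 5 = -(2 * n + 1)) ∧
      ((i.val : ℕ) % 2 = 1 → hF n (i - 1).val 3 = 2 * n + 1 - i.val ∧
        hF n (i - 1).val 4 = -(2 * n + 1) ∧ hF n (i - 1).val 5 = - i.val) := by
    generalize (i - 1).val = k at hv ⊢
    generalize i.val = q at hv ⊢
    unfold hF
    constructor <;> intro h <;> split_ifs with h' <;> simp <;> omega
  simp only [Fin.sum_univ_six, Fin.sum_univ_four, D, tl, hd, add_sub_cancel_right]
  rcases Nat.mod_two_eq_zero_or_one i.val with h | h
  · obtain ⟨h3, h4, h5⟩ := e3.1 h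
    rw [h3, h4, h5]
    simp [hF, eps, h]
    ring
  · obtain ⟨h3, h4, h5⟩ := e3.2 h
    rw [h3, h4, h5]
    simp [hF, eps, h]
    ring

/-- the black vertices -/
def BB (n : ℕ) : Set (ZMod (2 * n + 1) × Fin 4) := {v | eps v.1.val v.2 = 1}
/-- the white vertices -/
def WW (n : ℕ) : Set (ZMod (2 * n + 1) × Fin 4) := {v | eps v.1.val v.2 = -1}

open Classical in
lemma cut_bound (n : ℕ) (hn : 1 ≤ n) (X : Set (ZMod (2 * n + 1) × Fin 4)) :
    (4 * n + 1 : ℤ) * |((X ∩ BB n).ncard : ℤ) - ((X ∩ WW n).ncard : ℤ)| ≤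
      (2 * n + 1) * (({e | ¬ (tl e ∈ X ↔ hd e ∈ X)} : Set (ZMod (2 * n + 1) × Fin 6)).ncard : ℤ) := by
  have h1 : ((X ∩ BB n).ncard : ℤ) - ((X ∩ WW n).ncard : ℤ) =
      ∑ v : ZMod (2 * n + 1) × Fin 4, eps v.1.val v.2 * (if v ∈ X then 1 else 0) := by
    rw [Set.ncard_eq_toFinset_card', Set.ncard_eq_toFinset_card', ← Set.filter_mem_univ_eq_toFinset,
      ← Set.filter_mem_univ_eq_toFinset, Finset.card_filter, Finset.card_filter]
    push_cast
    rw [← Finset.sum_sub_distrib]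
    refine Finset.sum_congr rfl fun v _ => ?_
    have := eps_cases v.1.val v.2
    by_cases hX : v ∈ X <;> rcases this with h | h <;> simp [hX, BB, WW, h]
  have h2 : (({e | ¬ (tl e ∈ X ↔ hd e ∈ X)} : Set (ZMod (2 * n + 1) × Fin 6)).ncard : ℤ) =
      ∑ e : ZMod (2 * n + 1) × Fin 6,
        |(if tl e ∈ X then (1:ℤ) else 0) - (if hd e ∈ X then 1 else 0)| := by
    rw [Set.ncard_eq_toFinset_card', ← Set.filter_mem_univ_eq_toFinset, Finset.card_filter]
    push_cast
    refine Finset.sum_congr rfl fun e _ => ?_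
    by_cases a : tl e ∈ X <;> by_cases b : hd e ∈ X <;> simp [a, b]
  have h3 := sum_identity n hn (fun v => if v ∈ X then 1 else 0)
  rw [h1, h2, ← abs_of_nonneg (show (0:ℤ) ≤ 4 * n + 1 by positivity), ← abs_mul, ← h3,
    Finset.mul_sum]
  refine (Finset.abs_sum_le_sum_abs _ _).trans (Finset.sum_le_sum fun e _ => ?_)
  rw [abs_mul]
  refine mul_le_mul_of_nonneg_right (hF_bound _ _ ?_ _) (abs_nonneg _)
  have := ZMod.val_lt e.1
  omega

lemma rbip (n : ℕ) (hn : 1 ≤ n) :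
    (flowerSnark n hn).IsRBipartition (4 + 1 / (n : ℝ)) (BB n) (WW n) := by
  refine ⟨?_, ?_, ?_⟩
  · ext v
    exact iff_of_true (eps_cases v.1.val v.2) trivial
  · ext v
    refine iff_of_false ?_ id
    rintro ⟨h, h'⟩
    have h1 : eps v.1.val v.2 = 1 := h
    have h2 : eps v.1.val v.2 = -1 := h'
    omega
  · intro X
    have h := cut_bound n hn X
    have hc : (flowerSnark n hn).cut X =
        ({e | ¬ (tl e ∈ X ↔ hd e ∈ X)} : Set (ZMod (2 * n + 1) × Fin 6)) := by
      ext e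
      change ¬ ((flowerSnark n hn).tail e ∈ X ↔ (flowerSnark n hn).head e ∈ X) ↔
        ¬ (tl e ∈ X ↔ hd e ∈ X)
      rw [tail_eq n hn e, head_eq n hn e]
      exact Iff.rfl
    rw [hc]
    have hn' : (0:ℝ) < n := by exact_mod_cast hn
    have hr : (4 + 1 / (n:ℝ)) / (4 + 1 / (n:ℝ) - 2) = (4 * n + 1) / (2 * n + 1) := by
      have : (4 + 1 / (n:ℝ) - 2) ≠ 0 := by
        have : 0 < 1 / (n:ℝ) := by positivity
        linarith
      rw [div_eq_div_iff this (by positivity)]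
      field_simp
      ring
    rw [hr, div_mul_eq_mul_div, div_le_iff₀ (by positivity), mul_comm _ ((2:ℝ) * n + 1)]
    exact_mod_cast h

lemma pm (n : ℕ) (hn : 1 ≤ n) : (flowerSnark n hn).IsPerfectMatching
        {e : (flowerSnark n hn).E | e.2 = 0 ∨ e.2 = 5} := by
  rintro ⟨i, v⟩
  have key : ∃! e : ZMod (2 * n + 1) × Fin 6, (e.2 = 0 ∨ e.2 = 5) ∧ (tl e = (i, v) ∨ hd e = (i, v)) := by
    fin_cases v
    · refine ⟨(i, 0), by simp [tl, hd], ?_⟩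
      rintro ⟨k, j⟩ ⟨h | h, h'⟩ <;> simp at h <;> subst h <;> simp [tl, hd] at h' <;> simp [h']
    · refine ⟨(i, 0), by simp [tl, hd], ?_⟩
      rintro ⟨k, j⟩ ⟨h | h, h'⟩ <;> simp at h <;> subst h <;> simp [tl, hd] at h' <;> simp [h']
    · refine ⟨(i - 1, 5), by simp [tl, hd], ?_⟩
      rintro ⟨k, j⟩ ⟨h | h, h'⟩ <;> simp at h <;> subst h <;> simp [tl, hd] at h' <;> simp [← h']
    · refine ⟨(i, 5), by simp [tl, hd], ?_⟩
      rintro ⟨k, j⟩ ⟨h | h, h'⟩ <;> simp at h <;> subst h <;> simp [tl, hd] at h' <;> simp [h']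
  obtain ⟨e, he, hu⟩ := key
  refine ⟨e, ⟨he.1, ?_⟩, ?_⟩
  · exact (inc_iff n hn e (i, v)).mpr he.2
  · rintro e' ⟨h1, h2⟩
    exact hu e' ⟨h1, (inc_iff n hn e' (i, v)).mp h2⟩

lemma crossing (n : ℕ) (e : ZMod (2 * n + 1) × Fin 6) (he : e.2 = 0 ∨ e.2 = 5) :
    (tl e ∈ BB n ∧ hd e ∈ WW n) ∨ (tl e ∈ WW n ∧ hd e ∈ BB n) := by
  obtain ⟨i, j⟩ := e
  rcases he with h | h <;> simp at h <;> subst h <;> simp [tl, hd, BB, WW, eps] <;>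
    omega

/-- a proper 3-colouring of the odd cycle -/
def xc {n : ℕ} (i : ZMod (2 * n + 1)) : Fin 3 :=
  if i.val = 0 then 2 else if i.val % 2 = 0 then 0 else 1

lemma xc_ne (n : ℕ) (hn : 1 ≤ n) (i : ZMod (2 * n + 1)) : xc i ≠ xc (i + 1) := by
  have h := val_succ n hn i
  unfold xc
  split_ifs <;> omega

/-- colour of the copy `l` of an edge of type `j` when the two
consecutive cycle colours are given -/
def T (x x' : Fin 3) (j : Fin 6) (l : ℕ) : ℕ :=
  if 3 ≤ l then l + 2 else
  match j with
  | 0 => if l = 0 then 3 else if l = 1 then 4 else 3 - x.val - x'.val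
  | 1 => x.val
  | 2 => x'.val
  | 3 => x'.val
  | 4 => 3
  | 5 => if l = 0 then 4 else if l = 1 then (x'.val + 1) % 3 else (x'.val + 2) % 3

/-- offsets and types of the tail -/
def tloc (j : Fin 6) : Bool × Fin 4 :=
  (![false, false, false, false, false, true] j, ![1, 1, 1, 0, 2, 2] j)
/-- offsets and types of the head -/
def hloc (j : Fin 6) : Bool × Fin 4 :=
  (![false, false, false, true, true, false] j, ![0, 2, 3, 0, 3, 3] j)

/-- valid copy index -/
def okc (j : Fin 6) (l : ℕ) : Prop := l = 0 ∨ j = 0 ∨ j = 5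

instance (j : Fin 6) (l : ℕ) : Decidable (okc j l) := by unfold okc; infer_instance

lemma T_lt (x x' : Fin 3) (h : x ≠ x') (j : Fin 6) (l K : ℕ) (hl : l ≤ K) (hK : 2 ≤ K) :
    T x x' j l < K + 3 := by
  by_cases h3 : 3 ≤ l
  · simp [T, h3]; omega
  · have : ∀ x x' : Fin 3, x ≠ x' → ∀ j : Fin 6, ∀ l : Fin 3, T x x' j l < 5 := by decide
    have := this x x' h j ⟨l, by omega⟩
    simp only at this
    omega

lemma T_small (x x' : Fin 3) (h : x ≠ x') (j : Fin 6) (l : ℕ) (hl : l < 3) :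
    T x x' j l < 5 := T_lt x x' h j l 2 (by omega) le_rfl

lemma T_big (x x' : Fin 3) (j : Fin 6) (l : ℕ) (hl : 3 ≤ l) : T x x' j l = l + 2 := by
  simp [T, hl]

/-- two local edges sharing a vertex -/
def share (d d' : Bool) (j j' : Fin 6) : Prop :=
  ∃ v : Fin 4, (tloc j = (d, v) ∨ hloc j = (d, v)) ∧ (tloc j' = (d', v) ∨ hloc j' = (d', v))

instance (d d' : Bool) (j j' : Fin 6) : Decidable (share d d' j j') := by
  unfold share; infer_instance

set_option maxRecDepth 100000 in
set_option maxHeartbeats 4000000 in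
lemma T_same_small : ∀ x x' : Fin 3, x ≠ x' → ∀ j j' : Fin 6,
    (share false false j j' ∨ share true true j j') →
    ∀ l l' : Fin 3, okc j l → okc j' l' → (j ≠ j' ∨ l ≠ l') →
    T x x' j l ≠ T x x' j' l' := by decide

set_option maxRecDepth 100000 in
set_option maxHeartbeats 4000000 in
lemma T_next_small : ∀ x x' x'' : Fin 3, x ≠ x' → x' ≠ x'' → ∀ j j' : Fin 6,
    share true false j j' → ∀ l l' : Fin 3, okc j l → okc j' l' →
    T x x' j l ≠ T x' x'' j' l' := by decide

/-- two edges of type 0 or 5 that share a vertex have the same type -/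
lemma share_M : ∀ d d' : Bool, ∀ j j' : Fin 6, (j = 0 ∨ j = 5) → (j' = 0 ∨ j' = 5) →
    share d d' j j' → d = d' ∧ j = j' := by decide

lemma T_mixed (x x' y y' : Fin 3) (hx : x ≠ x') (hy : y ≠ y') (d d' : Bool) (j j' : Fin 6)
    (l l' : ℕ) (ho : okc j l) (ho' : okc j' l') (hs : share d d' j j')
    (hne : d = d' → (j ≠ j' ∨ l ≠ l')) (hbig : 3 ≤ l ∨ 3 ≤ l') :
    T x x' j l ≠ T y y' j' l' := by
  by_cases h : 3 ≤ l <;> by_cases h' : 3 ≤ l'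
  · rw [T_big _ _ _ _ h, T_big _ _ _ _ h']
    have a : j = 0 ∨ j = 5 := by unfold okc at ho; omega
    have b : j' = 0 ∨ j' = 5 := by unfold okc at ho'; omega
    obtain ⟨q, w⟩ := share_M d d' j j' a b hs
    have := hne q
    omega
  · rw [T_big _ _ _ _ h]
    have := T_small y y' hy j' l' (by omega)
    omega
  · rw [T_big _ _ _ _ h']
    have := T_small x x' hx j l (by omega)
    omega
  · omega

lemma T_same (x x' : Fin 3) (hx : x ≠ x') (d : Bool) (j j' : Fin 6)
    (l l' : ℕ) (ho : okc j l) (ho' : okc j' l') (hs : share d d j j')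
    (hne : (j ≠ j' ∨ l ≠ l')) : T x x' j l ≠ T x x' j' l' := by
  by_cases hbig : 3 ≤ l ∨ 3 ≤ l'
  · exact T_mixed x x' x x' hx hx d d j j' l l' ho ho' hs (fun _ => hne) hbig
  · push Not at hbig
    refine T_same_small x x' hx j j' ?_ ⟨l, hbig.1⟩ ⟨l', hbig.2⟩ ho ho' ?_
    · cases d <;> simp [hs]
    · simpa using hne

lemma T_next (x x' x'' : Fin 3) (hx : x ≠ x') (hx' : x' ≠ x'') (j j' : Fin 6)
    (l l' : ℕ) (ho : okc j l) (ho' : okc j' l') (hs : share true false j j') :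
    T x x' j l ≠ T x' x'' j' l' := by
  by_cases hbig : 3 ≤ l ∨ 3 ≤ l'
  · exact T_mixed x x' x' x'' hx hx' true false j j' l l' ho ho' hs (by simp) hbig
  · push Not at hbig
    exact T_next_small x x' x'' hx hx' j j' hs ⟨l, hbig.1⟩ ⟨l', hbig.2⟩ ho ho'

lemma tl_loc {n : ℕ} (i : ZMod (2 * n + 1)) (j : Fin 6) :
    tl (i, j) = (i + (if (tloc j).1 then 1 else 0), (tloc j).2) := by
  fin_cases j <;> simp [tl, tloc]

lemma hd_loc {n : ℕ} (i : ZMod (2 * n + 1)) (j : Fin 6) :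
    hd (i, j) = (i + (if (hloc j).1 then 1 else 0), (hloc j).2) := by
  fin_cases j <;> simp [hd, hloc]

lemma inc_loc {n : ℕ} (i : ZMod (2 * n + 1)) (j : Fin 6) (w : ZMod (2 * n + 1) × Fin 4)
    (h : tl (i, j) = w ∨ hd (i, j) = w) :
    ∃ d : Bool, w.1 = i + (if d then 1 else 0) ∧ (tloc j = (d, w.2) ∨ hloc j = (d, w.2)) := by
  rcases h with h | h
  · rw [tl_loc] at h
    refine ⟨(tloc j).1, by rw [← h], Or.inl (by rw [← h])⟩
  · rw [hd_loc] at h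
    refine ⟨(hloc j).1, by rw [← h], Or.inr (by rw [← h])⟩

lemma proper_aux (n : ℕ) (hn : 1 ≤ n) (i i' : ZMod (2 * n + 1)) (j j' : Fin 6) (l l' : ℕ)
    (ho : okc j l) (ho' : okc j' l') (w : ZMod (2 * n + 1) × Fin 4)
    (h : tl (i, j) = w ∨ hd (i, j) = w) (h' : tl (i', j') = w ∨ hd (i', j') = w)
    (hne : i = i' → j = j' → l ≠ l') :
    T (xc (i - 1)) (xc i) j l ≠ T (xc (i' - 1)) (xc i') j' l' := by
  have hx : ∀ k : ZMod (2 * n + 1), xc (k - 1) ≠ xc k := fun k => by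
    simpa using xc_ne n hn (k - 1)
  obtain ⟨d, hd1, hd2⟩ := inc_loc i j w h
  obtain ⟨d', hd1', hd2'⟩ := inc_loc i' j' w h'
  have hs : share d d' j j' := ⟨w.2, hd2, hd2'⟩
  have hs' : share d' d j' j := ⟨w.2, hd2', hd2⟩
  rw [hd1] at hd1'
  have same : ∀ (_ : i = i') (_ : d = d'), 
      T (xc (i - 1)) (xc i) j l ≠ T (xc (i' - 1)) (xc i') j' l' := by
    intro a b
    subst a b
    refine T_same _ _ (hx i) d j j' l l' ho ho' hs ?_
    by_cases q : j = j'
    · exact Or.inr (hne rfl q)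
    · exact Or.inl q
  cases d <;> cases d' <;> simp at hd1'
  · exact same hd1' rfl
  · subst hd1'
    have := T_next (xc (i' - 1)) (xc i') (xc (i' + 1)) (hx i') (xc_ne n hn i') j' j l' l ho' ho hs'
    rw [add_sub_cancel_right]
    exact this.symm
  · subst hd1'
    have := T_next (xc (i - 1)) (xc i) (xc (i + 1)) (hx i) (xc_ne n hn i) j j' l l' ho ho' hs
    rw [add_sub_cancel_right]
    exact this
  · exact same hd1' rfl

lemma class1_of (G : Multigraph) (k : ℕ) (c : G.E → Fin k) (hc : G.IsProperEdgeColoring c)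
    (v : G.V) (f : Fin k → G.E) (hf : Function.Injective f) (hv : ∀ a, G.Inc v (f a)) :
    G.IsClass1 := by
  have hle : ∀ (k' : ℕ) (c' : G.E → Fin k'), G.IsProperEdgeColoring c' → ∀ u, G.degree u ≤ k' := by
    intro k' c' hc' u
    have : Function.Injective (fun e : {e : G.E // G.Inc u e} => c' e.1) := by
      intro a b hab
      by_contra hne
      exact hc' a.1 b.1 ⟨fun h => hne (Subtype.ext h), u, a.2, b.2⟩ hab
    have := Nat.card_le_card_of_injective _ this
    simpa [Multigraph.degree] using this
  have hdeg : k ≤ G.degree v := by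
    have : Function.Injective (fun a : Fin k => (⟨f a, hv a⟩ : {e : G.E // G.Inc v e})) := by
      intro a b hab
      exact hf (congrArg Subtype.val hab)
    have := Nat.card_le_card_of_injective _ this
    simpa [Multigraph.degree] using this
  have h1 : G.chromaticIndex ≤ k := Nat.sInf_le ⟨c, hc⟩
  have h2 : k ≤ G.chromaticIndex := by
    have hm : G.chromaticIndex ∈ {k | ∃ c : G.E → Fin k, G.IsProperEdgeColoring c} :=
      Nat.sInf_mem ⟨k, c, hc⟩
    obtain ⟨c', hc'⟩ := hm
    exact hdeg.trans (hle _ c' hc' v)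
  have h3 : G.maxDegree = k := by
    apply le_antisymm
    · refine csSup_le ⟨_, v, rfl⟩ ?_
      rintro _ ⟨u, rfl⟩
      exact hle k c hc u
    · refine hdeg.trans (le_csSup ⟨k, ?_⟩ ⟨v, rfl⟩)
      rintro _ ⟨u, rfl⟩
      exact hle k c hc u
  unfold Multigraph.IsClass1
  omega

/-- the matching -/
abbrev MM (n : ℕ) (hn : 1 ≤ n) : Set (flowerSnark n hn).E := {e | e.2 = 0 ∨ e.2 = 5}

/-- underlying edge of an edge of `G + kM` -/
def base (n : ℕ) (hn : 1 ≤ n) (K : ℕ) :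
    ((flowerSnark n hn).addCopies (MM n hn) K).E → ZMod (2 * n + 1) × Fin 6
  | Sum.inl e => e
  | Sum.inr p => p.2.1

/-- copy index of an edge of `G + kM` -/
def idx (n : ℕ) (hn : 1 ≤ n) (K : ℕ) :
    ((flowerSnark n hn).addCopies (MM n hn) K).E → ℕ
  | Sum.inl _ => 0
  | Sum.inr p => p.1.val + 1

lemma base_inc (n : ℕ) (hn : 1 ≤ n) (K : ℕ) (e : ((flowerSnark n hn).addCopies (MM n hn) K).E)
    (w : ZMod (2 * n + 1) × Fin 4) :
    ((flowerSnark n hn).addCopies (MM n hn) K).Inc w e ↔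
      (tl (base n hn K e) = w ∨ hd (base n hn K e) = w) := by
  rw [← tail_eq n hn, ← head_eq n hn]
  rcases e with e | p <;> exact Iff.rfl

lemma base_okc (n : ℕ) (hn : 1 ≤ n) (K : ℕ) (e : ((flowerSnark n hn).addCopies (MM n hn) K).E) :
    okc (base n hn K e).2 (idx n hn K e) ∧ idx n hn K e ≤ K := by
  rcases e with e | p
  · exact ⟨Or.inl rfl, Nat.zero_le _⟩
  · exact ⟨Or.inr p.2.2, p.1.2⟩

lemma base_inj (n : ℕ) (hn : 1 ≤ n) (K : ℕ) (e e' : ((flowerSnark n hn).addCopies (MM n hn) K).E)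
    (h : base n hn K e = base n hn K e') (h' : idx n hn K e = idx n hn K e') : e = e' := by
  rcases e with e | ⟨l, e⟩ <;> rcases e' with e' | ⟨l', e'⟩
  · exact congrArg Sum.inl h
  · simp [idx] at h'
  · simp [idx] at h'
  · simp [idx] at h'
    have hl : l = l' := Fin.ext h'
    subst hl
    have he : e = e' := Subtype.ext h
    rw [he]

lemma star_exists (n : ℕ) (hn : 1 ≤ n) (K : ℕ) (a : Fin (K + 3)) :
    ∃ e : ((flowerSnark n hn).addCopies (MM n hn) K).E,
    base n hn K e = (0, if a.val ≤ K then 0 else if a.val = K + 1 then 1 else 2) ∧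
    idx n hn K e = if a.val < K then a.val + 1 else 0 := by
  by_cases h : a.val < K
  · rw [if_pos h, if_pos h.le]
    exact ⟨Sum.inr ⟨⟨a.val, h⟩, ⟨((0, 0) : ZMod (2 * n + 1) × Fin 6), Or.inl rfl⟩⟩, rfl, rfl⟩
  · rw [if_neg h]
    exact ⟨Sum.inl ((0, if a.val ≤ K then 0 else if a.val = K + 1 then 1 else 2) :
      ZMod (2 * n + 1) × Fin 6), rfl, rfl⟩

lemma class1 (n : ℕ) (hn : 1 ≤ n) (K : ℕ) (hK : 2 ≤ K) :
    ((flowerSnark n hn).addCopies (MM n hn) K).IsClass1 := by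
  have hx : ∀ k : ZMod (2 * n + 1), xc (k - 1) ≠ xc k := fun k => by
    simpa using xc_ne n hn (k - 1)
  choose star star_spec using star_exists n hn K
  refine class1_of _ (K + 3)
    (fun e => ⟨T (xc ((base n hn K e).1 - 1)) (xc (base n hn K e).1) (base n hn K e).2
      (idx n hn K e), T_lt _ _ (hx _) _ _ K (base_okc n hn K e).2 hK⟩) ?_
    ((0, 1) : ZMod (2 * n + 1) × Fin 4)
    star ?_ ?_
  · rintro e e' ⟨hne, w, hw, hw'⟩ heq
    have hw := (base_inc n hn K e w).mp hw
    have hw' := (base_inc n hn K e' w).mp hw'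
    refine proper_aux n hn (base n hn K e).1 (base n hn K e').1 (base n hn K e).2
      (base n hn K e').2 (idx n hn K e) (idx n hn K e') (base_okc n hn K e).1
      (base_okc n hn K e').1 w hw hw' ?_ (Fin.mk.inj_iff.mp heq)
    intro h1 h2 h3
    exact hne (base_inj n hn K e e' (Prod.ext h1 h2) h3)
  · intro a b hab
    have hb := congrArg (base n hn K) hab
    have hi := congrArg (idx n hn K) hab
    have ha2 := a.2
    have hb2 := b.2
    apply Fin.ext
    rw [(star_spec a).1, (star_spec b).1] at hb
    rw [(star_spec a).2, (star_spec b).2] at hi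
    have hb' := congrArg (fun e => e.2.val) hb
    dsimp only at hb'
    split_ifs at hb' hi <;> simp at hb' hi <;> omega
  · intro a
    refine (base_inc n hn K _ _).mpr (Or.inl ?_)
    rw [(star_spec a).1]
    split_ifs <;> simp [tl]

end FlowerAux

/-- for every `n ≥ 1`, the Flower snark `J_{2n+1}` has a
`(4 + 1/n)`-bipartition `(B, W)` such that the perfect matching
`M_n = {a_i b_i, c_{i+1} d_i : i ∈ ℤ_{2n+1}}` (the edges with index `0` or `5`
in our encoding) gives `J_{2n+1}` the `M_n`-class-1 property and every edge of
`M_n` has one end in `B` and the other in `W`. -/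
theorem statement_12 (n : ℕ) (hn : 1 ≤ n) :
    ∃ B W : Set (flowerSnark n hn).V,
      (flowerSnark n hn).IsRBipartition (4 + 1 / (n : ℝ)) B W ∧
      (flowerSnark n hn).IsPerfectMatching
        {e : (flowerSnark n hn).E | e.2 = 0 ∨ e.2 = 5} ∧
      (flowerSnark n hn).MClass1Property
        {e : (flowerSnark n hn).E | e.2 = 0 ∨ e.2 = 5} ∧
      ∀ e ∈ {e : (flowerSnark n hn).E | e.2 = 0 ∨ e.2 = 5},
        ((flowerSnark n hn).tail e ∈ B ∧ (flowerSnark n hn).head e ∈ W) ∨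
        ((flowerSnark n hn).tail e ∈ W ∧ (flowerSnark n hn).head e ∈ B) := by
  refine ⟨FlowerAux.BB n, FlowerAux.WW n, FlowerAux.rbip n hn, FlowerAux.pm n hn, ?_, ?_⟩
  · intro t ht
    exact FlowerAux.class1 n hn (2 * t - 2) (by omega)
  · intro e he
    have key := FlowerAux.crossing n e he
    rw [← FlowerAux.tail_eq n hn e, ← FlowerAux.head_eq n hn e] at key
    exact key
end

section
/- For every integer n ≥ 1 there exists a bridgeless cubic class 2 graph G with a (4 + 1/(n+1))-bipartition (B, W) and a perfect matching M such that G has the M-class-2 property and every edge of M has one end in B and the other in W. -/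
namespace Multigraph

/-- Signed incidence. -/
noncomputable def sg (G : Multigraph) (v : G.V) (e : G.E) : ℤ := by
  classical
  exact (if G.head e = v then 1 else 0) - (if G.tail e = v then 1 else 0)

/-- `p v`, `q v`, `r v` list the three edges at `v`. -/
structure Listing (G : Multigraph) (p q r : G.V → G.E) : Prop where
  inc : ∀ v e, G.Inc v e ↔ e = p v ∨ e = q v ∨ e = r v
  pq : ∀ v, p v ≠ q v
  pr : ∀ v, p v ≠ r v
  qr : ∀ v, q v ≠ r v

variable {G : Multigraph} {p q r : G.V → G.E}

theorem Listing.regular (h : Listing G p q r) : G.IsRegular 3 := by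
  intro v
  unfold degree
  have : {e : G.E | G.Inc v e} = {p v, q v, r v} := by
    ext e; simp [h.inc]
  change Nat.card ({e : G.E | G.Inc v e} : Set G.E) = 3
  rw [this, Nat.card_coe_set_eq, Set.ncard_eq_three]
  exact ⟨_, _, _, h.pq v, h.pr v, h.qr v, rfl⟩

theorem Listing.sum_sg (h : Listing G p q r) [Fintype G.E] (v : G.V) (g : G.E → ℤ) :
    ∑ e, G.sg v e * g e =
      G.sg v (p v) * g (p v) + G.sg v (q v) * g (q v) + G.sg v (r v) * g (r v) := by
  classical
  have h1 : ∑ e, G.sg v e * g e = ∑ e ∈ ({p v, q v, r v} : Finset G.E), G.sg v e * g e := by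
    symm
    apply Finset.sum_subset (Finset.subset_univ _)
    intro e _ he
    have : ¬ G.Inc v e := by
      rw [h.inc]; simpa using he
    unfold Inc at this
    push Not at this
    simp [sg, this.1, this.2]
  rw [h1, Finset.sum_insert, Finset.sum_insert, Finset.sum_singleton]
  · ring
  · simpa using h.qr v
  · simpa using ⟨h.pq v, h.pr v⟩

open Classical in
theorem sum_cut [Fintype G.V] [Fintype G.E] (X : Set G.V) (g : G.E → ℤ) :
    ∑ v ∈ Finset.univ.filter (· ∈ X), ∑ e, G.sg v e * g e =
      ∑ e ∈ Finset.univ.filter (fun e => G.head e ∈ X ∧ G.tail e ∉ X), g e -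
      ∑ e ∈ Finset.univ.filter (fun e => G.tail e ∈ X ∧ G.head e ∉ X), g e := by
  rw [Finset.sum_comm, Finset.sum_filter, Finset.sum_filter, ← Finset.sum_sub_distrib]
  apply Finset.sum_congr rfl
  intro e _
  rw [← Finset.sum_mul]
  have : ∑ i ∈ Finset.univ.filter (· ∈ X), G.sg i e =
      (if G.head e ∈ X then 1 else 0) - (if G.tail e ∈ X then 1 else 0) := by
    simp only [sg, Finset.sum_sub_distrib]
    simp [Finset.sum_ite_eq]
  rw [this]
  by_cases h1 : G.head e ∈ X <;> by_cases h2 : G.tail e ∈ X <;> simp [h1, h2]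

open Classical in
theorem Listing.flow_cut (h : Listing G p q r) [Fintype G.V] [Fintype G.E] (f : G.E → ℤ)
    (hf : ∀ v, G.sg v (p v) * f (p v) + G.sg v (q v) * f (q v) + G.sg v (r v) * f (r v) = 0)
    (X : Set G.V) :
      ∑ e ∈ Finset.univ.filter (fun e => G.head e ∈ X ∧ G.tail e ∉ X), f e =
      ∑ e ∈ Finset.univ.filter (fun e => G.tail e ∈ X ∧ G.head e ∉ X), f e := by
  have := sum_cut X f
  rw [Finset.sum_eq_zero] at this
  · linarith
  · intro v _
    rw [h.sum_sg, hf]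

theorem Listing.bridgeless (h : Listing G p q r) (f : G.E → ℤ) (hpos : ∀ e, 0 < f e)
    (hf : ∀ v, G.sg v (p v) * f (p v) + G.sg v (q v) * f (q v) + G.sg v (r v) * f (r v) = 0) :
    G.Bridgeless := by
  classical
  have := Fintype.ofFinite G.V
  have := Fintype.ofFinite G.E
  intro e he
  unfold IsBridge at he
  set X : Set G.V := {x | (G.deleteEdges {e}).Reach (G.tail e) x} with hX
  have htail : G.tail e ∈ X := Relation.ReflTransGen.refl
  have hhead : G.head e ∉ X := he
  have hadj : ∀ e', e' ≠ e → (G.tail e' ∈ X ↔ G.head e' ∈ X) := by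
    intro e' hne
    have a1 : (G.deleteEdges {e}).VAdj (G.tail e') (G.head e') := ⟨⟨e', hne⟩, Or.inl rfl⟩
    have a2 : (G.deleteEdges {e}).VAdj (G.head e') (G.tail e') := ⟨⟨e', hne⟩, Or.inr rfl⟩
    exact ⟨fun hh => Relation.ReflTransGen.tail hh a1, fun hh => Relation.ReflTransGen.tail hh a2⟩
  have := h.flow_cut f hf X
  have e1 : Finset.univ.filter (fun e => G.head e ∈ X ∧ G.tail e ∉ X) = ∅ := by
    apply Finset.filter_false_of_mem
    rintro e' - ⟨h1, h2⟩
    by_cases hne : e' = e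
    · subst hne; exact h2 htail
    · exact h2 ((hadj e' hne).2 h1)
  rw [e1, Finset.sum_empty] at this
  have hlt : 0 < ∑ e ∈ Finset.univ.filter (fun e => G.tail e ∈ X ∧ G.head e ∉ X), f e := by
    apply Finset.sum_pos (fun i _ => hpos i)
    exact ⟨e, by simp [htail, hhead]⟩
  linarith

theorem Listing.rbip (h : Listing G p q r) (f : G.E → ℤ) (m : ℕ) (hm : 1 ≤ m)
    (hlo : ∀ e, (m : ℤ) ≤ f e) (hhi : ∀ e, f e ≤ 3 * m + 1)
    (hf : ∀ v, G.sg v (p v) * f (p v) + G.sg v (q v) * f (q v) + G.sg v (r v) * f (r v) = 0)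
    (B : Set G.V) (hB : ∀ v ∈ B, G.sg v (p v) + G.sg v (q v) + G.sg v (r v) = -1)
    (hW : ∀ v, v ∉ B → G.sg v (p v) + G.sg v (q v) + G.sg v (r v) = 1) :
    G.IsRBipartition (4 + 1 / (m : ℝ)) B Bᶜ := by
  classical
  have := Fintype.ofFinite G.V
  have := Fintype.ofFinite G.E
  refine ⟨by simp, by simp, ?_⟩
  intro X
  have h1 := h.flow_cut f hf X
  have h2 := sum_cut X (fun _ : G.E => (1 : ℤ))
  set I := Finset.univ.filter (fun e => G.head e ∈ X ∧ G.tail e ∉ X) with hI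
  set O := Finset.univ.filter (fun e => G.tail e ∈ X ∧ G.head e ∉ X) with hO
  have h3 : ((G.cut X).ncard : ℤ) = I.card + O.card := by
    have : G.cut X = ((I ∪ O : Finset G.E) : Set G.E) := by
      ext e
      simp only [cut, hI, hO, Set.mem_ofPred_eq, Finset.coe_union, Set.mem_union, Finset.coe_filter,
        Finset.mem_univ, true_and]
      tauto
    rw [this, Set.ncard_coe_finset, Finset.card_union_of_disjoint]
    · push_cast; ring
    · rw [Finset.disjoint_left]
      intro e h1 h2
      simp [hI, hO] at h1 h2
      tauto
  have h4 : ((X ∩ B).ncard : ℤ) - ((X ∩ Bᶜ).ncard : ℤ) = O.card - I.card := by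
    have hh : ∑ v ∈ Finset.univ.filter (· ∈ X), ∑ e, G.sg v e * (1 : ℤ) =
        ∑ v ∈ Finset.univ.filter (· ∈ X), (if v ∈ B then (-1 : ℤ) else 1) := by
      apply Finset.sum_congr rfl
      intro v _
      rw [h.sum_sg]
      split_ifs with hv
      · linarith [hB v hv]
      · linarith [hW v hv]
    rw [hh, Finset.sum_ite] at h2
    have c1 : (X ∩ B).ncard = ((Finset.univ.filter (· ∈ X)).filter (· ∈ B)).card := by
      rw [← Set.ncard_coe_finset]; congr 1; ext; simp
    have c2 : (X ∩ Bᶜ).ncard = ((Finset.univ.filter (· ∈ X)).filter (· ∉ B)).card := by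
      rw [← Set.ncard_coe_finset]; congr 1; ext; simp
    rw [c1, c2]
    simp only [Finset.sum_const, nsmul_eq_mul, mul_one] at h2
    linarith
  have i1 : (m : ℤ) * I.card ≤ ∑ e ∈ I, f e := by
    have := Finset.card_nsmul_le_sum I f m (fun e _ => hlo e)
    simpa [mul_comm] using this
  have i2 : ∑ e ∈ I, f e ≤ (3 * m + 1) * I.card := by
    have := Finset.sum_le_card_nsmul I f (3 * m + 1) (fun e _ => hhi e)
    simpa [mul_comm] using this
  have o1 : (m : ℤ) * O.card ≤ ∑ e ∈ O, f e := by
    have := Finset.card_nsmul_le_sum O f m (fun e _ => hlo e)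
    simpa [mul_comm] using this
  have o2 : ∑ e ∈ O, f e ≤ (3 * m + 1) * O.card := by
    have := Finset.sum_le_card_nsmul O f (3 * m + 1) (fun e _ => hhi e)
    simpa [mul_comm] using this
  have k1 : (m : ℤ) * I.card ≤ (3 * m + 1) * O.card := by linarith
  have k2 : (m : ℤ) * O.card ≤ (3 * m + 1) * I.card := by linarith
  have k1' : (m : ℝ) * I.card ≤ (3 * m + 1) * O.card := by exact_mod_cast k1
  have k2' : (m : ℝ) * O.card ≤ (3 * m + 1) * I.card := by exact_mod_cast k2
  have h3' : ((G.cut X).ncard : ℝ) = I.card + O.card := by exact_mod_cast h3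
  have h4' : ((X ∩ B).ncard : ℝ) - ((X ∩ Bᶜ).ncard : ℝ) = O.card - I.card := by exact_mod_cast h4
  rw [h3', h4']
  have hm' : (1 : ℝ) ≤ m := by exact_mod_cast hm
  have hr : (4 + 1 / (m : ℝ)) / (4 + 1 / (m : ℝ) - 2) = (4 * m + 1) / (2 * m + 1) := by
    have : (4 + 1 / (m : ℝ) - 2) ≠ 0 := by
      have : (0 : ℝ) < 1 / m := by positivity
      linarith
    rw [div_eq_div_iff this (by positivity)]
    field_simp
    ring
  rw [hr, div_mul_eq_mul_div, div_le_iff₀ (by positivity)]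
  rcases abs_cases ((O.card : ℝ) - I.card) with ⟨ha, _⟩ | ⟨ha, _⟩ <;> rw [ha] <;> nlinarith

/-- A regular graph with no proper coloring in `d` colors is class 2. -/
theorem class2_of_no_coloring {H : Multigraph} [Nonempty H.V] {d : ℕ} (hd : H.IsRegular d)
    (hno : ∀ c : H.E → Fin d, ¬ H.IsProperEdgeColoring c) : H.IsClass2 := by
  intro h1
  unfold IsClass1 at h1
  have hmax : H.maxDegree = d := by
    unfold maxDegree
    have : Set.range H.degree = {d} := by
      ext x
      constructor
      · rintro ⟨v, rfl⟩; exact hd v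
      · rintro rfl
        exact ⟨Classical.arbitrary _, hd _⟩
    rw [this, csSup_singleton]
  have hne : {k | ∃ c : H.E → Fin k, H.IsProperEdgeColoring c}.Nonempty :=
    ⟨Nat.card H.E, Finite.equivFin H.E, fun e e' hh heq =>
      hh.1 ((Finite.equivFin H.E).injective heq)⟩
  have := Nat.sInf_mem hne
  change H.chromaticIndex ∈ _ at this
  rw [h1, hmax] at this
  obtain ⟨c, hc⟩ := this
  exact hno c hc

section copies

variable {M : Set G.E} (k : ℕ)

theorem Listing.bij (h : Listing G p q r) (hr : ∀ v, r v ∈ M) (hM : ∀ v e, e ∈ M → G.Inc v e → e = r v)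
    (v : G.V) :
    ∃ g : Fin 3 ⊕ Fin k → {e : (G.addCopies M k).E // (G.addCopies M k).Inc v e},
      Function.Bijective g := by
  have hinl : ∀ e : G.E, G.Inc v e → (G.addCopies M k).Inc v (Sum.inl e) := fun e he => he
  have hinr : ∀ i : Fin k, (G.addCopies M k).Inc v (Sum.inr ⟨i, ⟨r v, hr v⟩⟩) := fun i =>
    (h.inc v (r v)).2 (by simp)
  refine ⟨Sum.elim ![⟨Sum.inl (p v), hinl _ ((h.inc v _).2 (by simp))⟩,
      ⟨Sum.inl (q v), hinl _ ((h.inc v _).2 (by simp))⟩,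
      ⟨Sum.inl (r v), hinl _ ((h.inc v _).2 (by simp))⟩]
    (fun i => ⟨Sum.inr ⟨i, ⟨r v, hr v⟩⟩, hinr i⟩), ?_, ?_⟩
  · have a1 := h.pq v
    have a2 := h.pr v
    have a3 := h.qr v
    rintro (i | i) (j | j) hij
    · have hval := congrArg Subtype.val hij
      fin_cases i <;> fin_cases j <;>
        first
        | rfl
        | exact absurd (Sum.inl_injective hval) a1
        | exact absurd (Sum.inl_injective hval) a2
        | exact absurd (Sum.inl_injective hval) a3
        | exact absurd (Sum.inl_injective hval).symm a1
        | exact absurd (Sum.inl_injective hval).symm a2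
        | exact absurd (Sum.inl_injective hval).symm a3
    · exfalso
      have := congrArg Subtype.val hij
      fin_cases i <;> exact absurd this Sum.inl_ne_inr
    · exfalso
      have := congrArg Subtype.val hij
      fin_cases j <;> exact absurd this Sum.inr_ne_inl
    · have := Sum.inr_injective (congrArg Subtype.val hij)
      simp at this
      rw [this]
  · rintro ⟨e | ⟨i, e, he⟩, hv⟩
    · have hv' : G.Inc v e := hv
      rcases (h.inc v e).1 hv' with rfl | rfl | rfl
      · exact ⟨Sum.inl 0, rfl⟩
      · exact ⟨Sum.inl 1, rfl⟩
      · exact ⟨Sum.inl 2, rfl⟩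
    · have hv' : G.Inc v e := hv
      have := hM v e he hv'
      subst this
      exact ⟨Sum.inr i, rfl⟩

theorem Listing.regular_copies (h : Listing G p q r) (hr : ∀ v, r v ∈ M)
    (hM : ∀ v e, e ∈ M → G.Inc v e → e = r v) : (G.addCopies M k).IsRegular (3 + k) := by
  intro v
  obtain ⟨g, hg⟩ := h.bij k hr hM v
  unfold degree
  rw [← Nat.card_congr (Equiv.ofBijective g hg)]
  simp

theorem Listing.pairs (h : Listing G p q r) (hr : ∀ v, r v ∈ M)
    (hM : ∀ v e, e ∈ M → G.Inc v e → e = r v)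
    (c : (G.addCopies M k).E → Fin (3 + k)) (hc : (G.addCopies M k).IsProperEdgeColoring c)
    (x y : G.V) (hxy : r x = r y) (e : G.E) (he : e = p x ∨ e = q x) :
    c (Sum.inl e) = c (Sum.inl (p y)) ∨ c (Sum.inl e) = c (Sum.inl (q y)) := by
  obtain ⟨g, hg⟩ := h.bij k hr hM y
  have hne : e ≠ r x := by
    rcases he with rfl | rfl
    · exact h.pr x
    · exact h.qr x
  have hex : G.Inc x e := (h.inc x e).2 (by tauto)
  have hinj : Function.Injective (fun t => c (g t).1) := by
    intro s t hst
    by_contra hne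
    refine hc (g s).1 (g t).1 ⟨fun hh => hne (hg.1 (Subtype.ext hh)), y, (g s).2, (g t).2⟩ hst
  have hsurj : Function.Surjective (fun t => c (g t).1) := by
    have := (Fintype.bijective_iff_injective_and_card (fun t => c (g t).1)).2 ⟨hinj, by simp⟩
    exact this.2
  obtain ⟨t, ht⟩ := hsurj (c (Sum.inl e))
  simp only at ht
  rcases hgt : g t with ⟨e' | ⟨i, e', he'⟩, hv⟩
  · rw [hgt] at ht
    have hv' : G.Inc y e' := hv
    rcases (h.inc y e').1 hv' with rfl | rfl | rfl
    · exact Or.inl ht.symm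
    · exact Or.inr ht.symm
    · exfalso
      refine hc (Sum.inl (r y)) (Sum.inl e) ⟨?_, x, ?_, hex⟩ ht
      · intro hh
        exact hne (by rw [hxy]; exact (Sum.inl_injective hh).symm)
      · have : G.Inc x (r x) := (h.inc x _).2 (by simp)
        rw [hxy] at this
        exact this
  · rw [hgt] at ht
    exfalso
    have hv' : G.Inc y e' := hv
    have h5 := hM y e' he' hv'
    refine hc (Sum.inr ⟨i, e', he'⟩) (Sum.inl e) ⟨Sum.inr_ne_inl, x, ?_, hex⟩ ht
    have : G.Inc x (r x) := (h.inc x _).2 (by simp)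
    rw [hxy, ← h5] at this
    exact this

theorem Listing.distinct (h : Listing G p q r)
    (c : (G.addCopies M k).E → Fin (3 + k)) (hc : (G.addCopies M k).IsProperEdgeColoring c)
    (x : G.V) : c (Sum.inl (p x)) ≠ c (Sum.inl (q x)) := by
  refine hc _ _ ⟨fun hh => h.pq x (Sum.inl_injective hh), x, ?_, ?_⟩
  · exact (h.inc x (p x)).2 (by simp)
  · exact (h.inc x (q x)).2 (by simp)

end copies

/-- Main reduction: if no map on edges has the matched-pair property, everything is class 2. -/
theorem Listing.no_coloring (h : Listing G p q r) {M : Set G.E} (hr : ∀ v, r v ∈ M)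
    (hM : ∀ v e, e ∈ M → G.Inc v e → e = r v)
    (hno : ∀ c : G.E → ℕ, (∀ x, c (p x) ≠ c (q x)) →
      (∀ x y, r x = r y → (c (p x) = c (p y) ∨ c (p x) = c (q y)) ∧
        (c (q x) = c (p y) ∨ c (q x) = c (q y))) → False) (k : ℕ)
    (c : (G.addCopies M k).E → Fin (3 + k)) : ¬ (G.addCopies M k).IsProperEdgeColoring c := by
  intro hc
  refine hno (fun e => (c (Sum.inl e)).val) ?_ ?_
  · intro x hx
    exact h.distinct k c hc x (Fin.ext hx)
  · intro x y hxy
    simp only [← Fin.ext_iff]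
    exact ⟨h.pairs k hr hM c hc x y hxy _ (Or.inl rfl), h.pairs k hr hM c hc x y hxy _ (Or.inr rfl)⟩

theorem Listing.class2 (h : Listing G p q r) [Nonempty G.V] {M : Set G.E} (hr : ∀ v, r v ∈ M)
    (hM : ∀ v e, e ∈ M → G.Inc v e → e = r v)
    (hno : ∀ c : G.E → ℕ, (∀ x, c (p x) ≠ c (q x)) →
      (∀ x y, r x = r y → (c (p x) = c (p y) ∨ c (p x) = c (q y)) ∧
        (c (q x) = c (p y) ∨ c (q x) = c (q y))) → False) :
    G.IsClass2 ∧ G.MClass2Property M := by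
  constructor
  · apply class2_of_no_coloring h.regular
    intro c hc
    refine h.no_coloring hr hM hno 0 (Sum.elim c (fun t => t.1.elim0)) ?_
    rintro (e | ⟨i, _⟩) (e' | ⟨i', _⟩) ⟨hne, v, h1, h2⟩
    · exact hc e e' ⟨fun hh => hne (by rw [hh]), v, h1, h2⟩
    · exact i'.elim0
    · exact i.elim0
    · exact i.elim0
  · intro t _
    have : Nonempty (G.addCopies M (2 * t - 2)).V := ‹Nonempty G.V›
    exact class2_of_no_coloring (h.regular_copies _ hr hM) (h.no_coloring hr hM hno _)

end Multigraph

namespace Chain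

/-- Vertices of one block. -/
inductive BV
  | A | B | x1 | x2 | x3 | x4 | x6 | x7 | x8 | x9
  deriving DecidableEq

/-- Edges of one block. -/
inductive BE
  | al | be | ga | eA | e43 | e32 | e21 | e79 | e96 | e68 | rg | m1 | m2 | m3 | m4
  deriving DecidableEq

/-- The three exceptional edges. -/
inductive XE
  | uv | end1 | end2
  deriving DecidableEq

instance : Fintype BV := ⟨{.A, .B, .x1, .x2, .x3, .x4, .x6, .x7, .x8, .x9}, by intro x; cases x <;> simp⟩
instance : Fintype BE := ⟨{.al, .be, .ga, .eA, .e43, .e32, .e21, .e79, .e96, .e68, .rg, .m1, .m2, .m3, .m4}, by intro x; cases x <;> simp⟩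
instance : Fintype XE := ⟨{.uv, .end1, .end2}, by intro x; cases x <;> simp⟩

abbrev VV (n : ℕ) := Bool ⊕ (Fin (n + 1) × BV)
abbrev EE (n : ℕ) := XE ⊕ (Fin (n + 1) × BE)

variable {n : ℕ}

/-- The vertex `w` in the previous block, or the cap vertex `z` for the first block. -/
def prev (k : Fin (n + 1)) (z : Bool) (w : BV) : VV n :=
  if k.val = 0 then Sum.inl z else Sum.inr (⟨k.val - 1, by omega⟩, w)

/-- The edge `w` in the next block, or the end edge `z` for the last block. -/
def next (k : Fin (n + 1)) (z : XE) (w : BE) : EE n :=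
  if h : k.val = n then Sum.inl z else Sum.inr (⟨k.val + 1, by omega⟩, w)

def tl : EE n → VV n
  | .inl .uv => .inl false
  | .inl .end1 => .inr (Fin.last n, .x1)
  | .inl .end2 => .inl true
  | .inr (k, .al) => .inr (k, .A)
  | .inr (k, .be) => prev k false .x1
  | .inr (k, .ga) => .inr (k, .x8)
  | .inr (k, .eA) => .inr (k, .A)
  | .inr (k, .e43) => .inr (k, .x4)
  | .inr (k, .e32) => .inr (k, .x3)
  | .inr (k, .e21) => .inr (k, .x2)
  | .inr (k, .e79) => .inr (k, .x7)
  | .inr (k, .e96) => .inr (k, .x9)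
  | .inr (k, .e68) => .inr (k, .x6)
  | .inr (k, .rg) => .inr (k, .B)
  | .inr (k, .m1) => .inr (k, .x1)
  | .inr (k, .m2) => .inr (k, .x2)
  | .inr (k, .m3) => .inr (k, .x8)
  | .inr (k, .m4) => .inr (k, .x9)

def hd : EE n → VV n
  | .inl .uv => .inl true
  | .inl .end1 => .inr (Fin.last n, .B)
  | .inl .end2 => .inr (Fin.last n, .x7)
  | .inr (k, .al) => prev k false .B
  | .inr (k, .be) => .inr (k, .B)
  | .inr (k, .ga) => prev k true .x7
  | .inr (k, .eA) => .inr (k, .x4)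
  | .inr (k, .e43) => .inr (k, .x3)
  | .inr (k, .e32) => .inr (k, .x2)
  | .inr (k, .e21) => .inr (k, .x1)
  | .inr (k, .e79) => .inr (k, .x9)
  | .inr (k, .e96) => .inr (k, .x6)
  | .inr (k, .e68) => .inr (k, .x8)
  | .inr (k, .rg) => .inr (k, .A)
  | .inr (k, .m1) => .inr (k, .x6)
  | .inr (k, .m2) => .inr (k, .x7)
  | .inr (k, .m3) => .inr (k, .x3)
  | .inr (k, .m4) => .inr (k, .x4)

/-- Flow values (scaled by `n + 1`). -/
def fl : EE n → ℤ
  | .inl .uv => n + 1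
  | .inl .end1 => n + 2
  | .inl .end2 => 2 * n + 2
  | .inr (k, .al) => 2 * n + 3 - k.val
  | .inr (_, .be) => n + 2
  | .inr (k, .ga) => n + 1 + k.val
  | .inr (_, .eA) => n + 1
  | .inr (_, .e43) => 2 * n + 2
  | .inr (_, .e32) => 3 * n + 4
  | .inr (_, .e21) => 2 * n + 3
  | .inr (k, .e79) => 2 * n + 3 + k.val
  | .inr (k, .e96) => n + 2 + k.val
  | .inr (k, .e68) => 2 * n + 3 + k.val
  | .inr (k, .rg) => 3 * n + 4 - k.val
  | .inr (_, .m1) => n + 1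
  | .inr (_, .m2) => n + 1
  | .inr (_, .m3) => n + 2
  | .inr (_, .m4) => n + 1

/-- First non-matching edge at a vertex. -/
def pp : VV n → EE n
  | .inl false => .inr (0, .al)
  | .inl true => .inr (0, .ga)
  | .inr (k, .A) => .inr (k, .al)
  | .inr (k, .B) => .inr (k, .be)
  | .inr (k, .x1) => .inr (k, .e21)
  | .inr (k, .x2) => .inr (k, .e32)
  | .inr (k, .x3) => .inr (k, .e43)
  | .inr (k, .x4) => .inr (k, .eA)
  | .inr (k, .x6) => .inr (k, .e96)
  | .inr (k, .x7) => .inr (k, .e79)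
  | .inr (k, .x8) => .inr (k, .ga)
  | .inr (k, .x9) => .inr (k, .e79)

/-- Second non-matching edge at a vertex. -/
def qq : VV n → EE n
  | .inl false => .inr (0, .be)
  | .inl true => .inl .end2
  | .inr (k, .A) => .inr (k, .eA)
  | .inr (k, .B) => next k .end1 .al
  | .inr (k, .x1) => next k .end1 .be
  | .inr (k, .x2) => .inr (k, .e21)
  | .inr (k, .x3) => .inr (k, .e32)
  | .inr (k, .x4) => .inr (k, .e43)
  | .inr (k, .x6) => .inr (k, .e68)
  | .inr (k, .x7) => next k .end2 .ga
  | .inr (k, .x8) => .inr (k, .e68)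
  | .inr (k, .x9) => .inr (k, .e96)

/-- The matching edge at a vertex. -/
def rr : VV n → EE n
  | .inl _ => .inl .uv
  | .inr (k, .A) => .inr (k, .rg)
  | .inr (k, .B) => .inr (k, .rg)
  | .inr (k, .x1) => .inr (k, .m1)
  | .inr (k, .x2) => .inr (k, .m2)
  | .inr (k, .x3) => .inr (k, .m3)
  | .inr (k, .x4) => .inr (k, .m4)
  | .inr (k, .x6) => .inr (k, .m1)
  | .inr (k, .x7) => .inr (k, .m2)
  | .inr (k, .x8) => .inr (k, .m3)
  | .inr (k, .x9) => .inr (k, .m4)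

/-- The vertices with two outgoing edges. -/
def inB : VV n → Prop
  | .inl b => b = false
  | .inr (_, w) => w = .A ∨ w = .x1 ∨ w = .x2 ∨ w = .x8 ∨ w = .x9

theorem tl_ne_hd (e : EE n) : tl e ≠ hd e := by
  rcases e with e | ⟨k, e⟩ <;> cases e <;> simp [tl, hd, prev] <;> split_ifs <;> simp

/-- The graph. -/
def GG (n : ℕ) : Multigraph where
  V := VV n
  E := EE n
  vFinite := inferInstance
  eFinite := inferInstance
  ends := fun e => (tl e, hd e)
  no_loop := tl_ne_hd

theorem tl_next_be (k : Fin (n + 1)) : tl (next k .end1 .be) = .inr (k, .x1) := by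
  unfold next; split_ifs with h
  · simp [tl, Fin.ext_iff, h]
  · simp [tl, prev]

theorem hd_next_al (k : Fin (n + 1)) : hd (next k .end1 .al) = .inr (k, .B) := by
  unfold next; split_ifs with h
  · simp [hd, Fin.ext_iff, h]
  · simp [hd, prev]

theorem hd_next_ga (k : Fin (n + 1)) : hd (next k .end2 .ga) = .inr (k, .x7) := by
  unfold next; split_ifs with h
  · simp [hd, Fin.ext_iff, h]
  · simp [hd, prev]

theorem hd_next_be (k : Fin (n + 1)) : hd (next k .end1 .be) ≠ .inr (k, .x1) := by
  unfold next; split_ifs with h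
  · simp [hd]
  · simp [hd]

theorem tl_next_al (k : Fin (n + 1)) : tl (next k .end1 .al) ≠ .inr (k, .B) := by
  unfold next; split_ifs with h
  · simp [tl]
  · simp [tl]

theorem tl_next_ga (k : Fin (n + 1)) : tl (next k .end2 .ga) ≠ .inr (k, .x7) := by
  unfold next; split_ifs with h
  · simp [tl]
  · simp [tl]

theorem fl_next_al (k : Fin (n + 1)) : fl (next k .end1 .al) = 2 * n + 2 - k.val := by
  unfold next; split_ifs with h
  · simp [fl, h]; ring
  · simp [fl]; ring

theorem fl_next_be (k : Fin (n + 1)) : fl (next k .end1 .be) = n + 2 := by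
  unfold next; split_ifs with h <;> simp [fl]

theorem fl_next_ga (k : Fin (n + 1)) : fl (next k .end2 .ga) = n + 2 + k.val := by
  unfold next; split_ifs with h
  · simp [fl, h]; ring
  · simp [fl]; ring

theorem prev_eq_inl (k : Fin (n + 1)) (z y : Bool) (w : BV) :
    prev k z w = .inl y ↔ k = 0 ∧ z = y := by
  unfold prev; split_ifs with h <;> simp [Fin.ext_iff, h]

theorem prev_eq_inr (k : Fin (n + 1)) (z : Bool) (w w' : BV) (j : Fin (n + 1)) :
    prev k z w = .inr (j, w') ↔ k.val = j.val + 1 ∧ w = w' := by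
  unfold prev; split_ifs with h <;> simp [Fin.ext_iff] <;> omega

theorem inl_eq_next (k : Fin (n + 1)) (z y : XE) (w : BE) :
    .inl y = next k z w ↔ k = Fin.last n ∧ y = z := by
  unfold next; split_ifs with h <;> simp [Fin.ext_iff, h]

theorem inr_eq_next (k j : Fin (n + 1)) (z : XE) (w w' : BE) :
    .inr (j, w') = next k z w ↔ j.val = k.val + 1 ∧ w' = w := by
  unfold next; split_ifs with h <;> simp [Fin.ext_iff] <;> omega

theorem next_eq_inr (k j : Fin (n + 1)) (z : XE) (w w' : BE) :
    next k z w = .inr (j, w') ↔ j.val = k.val + 1 ∧ w' = w := by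
  rw [eq_comm, inr_eq_next]

theorem next_eq_inl (k : Fin (n + 1)) (z y : XE) (w : BE) :
    next k z w = .inl y ↔ k = Fin.last n ∧ y = z := by
  rw [eq_comm, inl_eq_next]

theorem inc_iff (v : VV n) (e : EE n) :
    (tl e = v ∨ hd e = v) ↔ (e = pp v ∨ e = qq v ∨ e = rr v) := by
  rcases v with (_ | _) | ⟨j, v⟩ <;> rcases e with e | ⟨k, e⟩ <;> cases e <;> try cases v
  all_goals
    simp [tl, hd, pp, qq, rr, prev_eq_inl, prev_eq_inr, inl_eq_next, inr_eq_next]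
  all_goals try exact eq_comm

theorem pp_ne_qq (v : VV n) : pp v ≠ qq v := by
  rcases v with (_ | _) | ⟨k, v⟩ <;> try cases v
  all_goals simp [pp, qq, inr_eq_next]

/-- The perfect matching. -/
def MM (n : ℕ) : Set (EE n) := Set.range rr

theorem pp_notin (v : VV n) : pp v ∉ MM n := by
  rintro ⟨w, hw⟩
  rcases v with (_ | _) | ⟨k, v⟩ <;> rcases w with w | ⟨j, w⟩ <;> try cases v
  all_goals try cases w
  all_goals simp [pp, rr] at hw

theorem qq_notin (v : VV n) : qq v ∉ MM n := by
  rintro ⟨w, hw⟩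
  rcases v with (_ | _) | ⟨k, v⟩ <;> rcases w with w | ⟨j, w⟩ <;> try cases v
  all_goals try cases w
  all_goals simp [qq, rr, inl_eq_next, inr_eq_next] at hw

theorem rr_mem (v : VV n) : rr v ∈ MM n := ⟨v, rfl⟩

theorem listing : Multigraph.Listing (GG n) pp qq rr where
  inc := inc_iff
  pq := pp_ne_qq
  pr := fun v h => pp_notin v (h ▸ rr_mem v)
  qr := fun v h => qq_notin v (h ▸ rr_mem v)

theorem mem_inc (v : VV n) (e : EE n) (he : e ∈ MM n) (hi : (GG n).Inc v e) : e = rr v := by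
  rcases (inc_iff v e).1 hi with h | h | h
  · subst h; exact absurd he (pp_notin v)
  · subst h; exact absurd he (qq_notin v)
  · exact h

/-- Decidable version of the signed incidence. -/
def sg' (v : VV n) (e : EE n) : ℤ :=
  (if hd e = v then 1 else 0) - (if tl e = v then 1 else 0)

theorem sg_eq (v : VV n) (e : EE n) : (GG n).sg v e = sg' v e := by
  unfold Multigraph.sg sg'
  congr

theorem conserve (v : VV n) :
    sg' v (pp v) * fl (pp v) + sg' v (qq v) * fl (qq v) + sg' v (rr v) * fl (rr v) = 0 := by
  rcases v with (_ | _) | ⟨k, v⟩ <;> try cases v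
  all_goals
    simp [sg', pp, qq, rr, tl_next_be, hd_next_al, hd_next_ga, hd_next_be, tl_next_al,
      tl_next_ga, fl_next_al, fl_next_be, fl_next_ga]
  all_goals simp [tl, hd, fl, prev_eq_inl, prev_eq_inr]
  all_goals try ring

theorem sumB (v : VV n) (h : inB v) : sg' v (pp v) + sg' v (qq v) + sg' v (rr v) = -1 := by
  rcases v with (_ | _) | ⟨k, v⟩ <;> try cases v
  all_goals simp [inB] at h
  all_goals simp [sg', pp, qq, rr, tl_next_be, hd_next_be]
  all_goals simp [tl, hd, prev_eq_inl, prev_eq_inr]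

theorem sumW (v : VV n) (h : ¬ inB v) : sg' v (pp v) + sg' v (qq v) + sg' v (rr v) = 1 := by
  rcases v with (_ | _) | ⟨k, v⟩ <;> try cases v
  all_goals simp [inB] at h
  all_goals simp [sg', pp, qq, rr, hd_next_al, hd_next_ga, tl_next_al, tl_next_ga]
  all_goals simp [tl, hd, prev_eq_inl, prev_eq_inr]

theorem fl_bounds (e : EE n) : ((n + 1 : ℕ) : ℤ) ≤ fl e ∧ fl e ≤ 3 * ((n + 1 : ℕ) : ℤ) + 1 := by
  rcases e with e | ⟨k, e⟩ <;> cases e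
  all_goals
    simp only [fl]
    try have := k.isLt
    push_cast
    omega

theorem MM_joins (e : EE n) (he : e ∈ MM n) :
    (inB (tl e) ∧ ¬ inB (hd e)) ∨ (¬ inB (tl e) ∧ inB (hd e)) := by
  obtain ⟨v, rfl⟩ := he
  rcases v with (_ | _) | ⟨k, v⟩ <;> try cases v
  all_goals simp [rr, tl, hd, inB]

theorem conserve_of (s : VV n → EE n → ℤ) (h : s = sg') (v : VV n) :
    s v (pp v) * fl (pp v) + s v (qq v) * fl (qq v) + s v (rr v) * fl (rr v) = 0 := by
  subst h; exact conserve v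

theorem sumB_of (s : VV n → EE n → ℤ) (h : s = sg') (v : VV n) (hv : inB v) :
    s v (pp v) + s v (qq v) + s v (rr v) = -1 := by
  subst h; exact sumB v hv

theorem sumW_of (s : VV n → EE n → ℤ) (h : s = sg') (v : VV n) (hv : ¬ inB v) :
    s v (pp v) + s v (qq v) + s v (rr v) = 1 := by
  subst h; exact sumW v hv

theorem sg_fun : ((GG n).sg : VV n → EE n → ℤ) = sg' :=
  funext fun v => funext fun e => sg_eq v e

/-- Pair equality as used in the colouring argument. -/
def PE (a b c d : ℕ) : Prop := (a = c ∨ a = d) ∧ (b = c ∨ b = d)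

theorem step_arith (a b g d p1 a' p2 p3 p4 b' q2 q3 q4 g' : ℕ)
    (hab : a ≠ b) (hI : (a = g ∧ b = d) ∨ (a = d ∧ b = g))
    (hA : a ≠ p1) (hAB : PE a p1 b a')
    (h4 : p1 ≠ p2) (h3 : p2 ≠ p3) (h2 : p3 ≠ p4) (h1 : p4 ≠ b')
    (h9 : q4 ≠ q3) (h8 : g ≠ q2) (h7 : q4 ≠ g') (h6 : q3 ≠ q2)
    (M4 : PE p1 p2 q4 q3) (M3 : PE p2 p3 g q2) (M2 : PE p3 p4 q4 g') (M1 : PE p4 b' q3 q2) :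
    a' = a ∧ a ≠ b' ∧ ((a = g' ∧ b' = d) ∨ (a = d ∧ b' = g')) := by
  have e1 : a' = a := by unfold PE at hAB; omega
  have e2 : p1 = b := by unfold PE at hAB; omega
  subst e1 e2
  refine ⟨rfl, ?_⟩
  unfold PE at *
  clear hAB
  grind

theorem no_col (c : EE n → ℕ) (h1 : ∀ x, c (pp x) ≠ c (qq x))
    (h2 : ∀ x y, rr x = rr y → PE (c (pp x)) (c (qq x)) (c (pp y)) (c (qq y))) : False := by
  have step : ∀ k : Fin (n + 1),
      c (.inr (k, .al)) ≠ c (.inr (k, .be)) →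
      ((c (.inr (k, .al)) = c (.inr (k, .ga)) ∧ c (.inr (k, .be)) = c (.inl .end2)) ∨
        (c (.inr (k, .al)) = c (.inl .end2) ∧ c (.inr (k, .be)) = c (.inr (k, .ga)))) →
      c (next k .end1 .al) ≠ c (next k .end1 .be) ∧
      ((c (next k .end1 .al) = c (next k .end2 .ga) ∧ c (next k .end1 .be) = c (.inl .end2)) ∨
        (c (next k .end1 .al) = c (.inl .end2) ∧
          c (next k .end1 .be) = c (next k .end2 .ga))) := by
    intro k hab hI
    obtain ⟨e, r1, r2⟩ := step_arith _ _ _ _ _ _ _ _ _ _ _ _ _ _ hab hI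
      (h1 (.inr (k, .A))) (h2 (.inr (k, .A)) (.inr (k, .B)) rfl)
      (h1 (.inr (k, .x4))) (h1 (.inr (k, .x3))) (h1 (.inr (k, .x2))) (h1 (.inr (k, .x1)))
      (h1 (.inr (k, .x9))) (h1 (.inr (k, .x8))) (h1 (.inr (k, .x7))) (h1 (.inr (k, .x6)))
      (h2 (.inr (k, .x4)) (.inr (k, .x9)) rfl) (h2 (.inr (k, .x3)) (.inr (k, .x8)) rfl)
      (h2 (.inr (k, .x2)) (.inr (k, .x7)) rfl) (h2 (.inr (k, .x1)) (.inr (k, .x6)) rfl)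
    change c (next k .end1 .al) = c (.inr (k, .al)) at e
    rw [e]
    exact ⟨r1, r2⟩
  have inv : ∀ (i : ℕ) (hi : i < n + 1),
      c (.inr (⟨i, hi⟩, .al)) ≠ c (.inr (⟨i, hi⟩, .be)) ∧
      ((c (.inr (⟨i, hi⟩, .al)) = c (.inr (⟨i, hi⟩, .ga)) ∧
          c (.inr (⟨i, hi⟩, .be)) = c (.inl .end2)) ∨
        (c (.inr (⟨i, hi⟩, .al)) = c (.inl .end2) ∧
          c (.inr (⟨i, hi⟩, .be)) = c (.inr (⟨i, hi⟩, .ga)))) := by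
    intro i
    induction i with
    | zero =>
      intro hi
      have a1 : c (.inr (0, .al)) ≠ c (.inr (0, .be)) := h1 (.inl false)
      have a2 : PE (c (.inr (0, .al))) (c (.inr (0, .be))) (c (.inr (0, .ga)))
        (c (.inl .end2)) := h2 (.inl false) (.inl true) rfl
      change c (.inr (0, .al)) ≠ c (.inr (0, .be)) ∧
        ((c (.inr (0, .al)) = c (.inr (0, .ga)) ∧ c (.inr (0, .be)) = c (.inl .end2)) ∨
        (c (.inr (0, .al)) = c (.inl .end2) ∧ c (.inr (0, .be)) = c (.inr (0, .ga))))
      unfold PE at a2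
      omega
    | succ i ih =>
      intro hi
      have hi' : i < n + 1 := by omega
      obtain ⟨r1, r2⟩ := ih hi'
      have s := step ⟨i, hi'⟩ r1 r2
      have hn : i ≠ n := by omega
      simpa [next, hn] using s
  obtain ⟨r1, r2⟩ := inv n (by omega)
  obtain ⟨s, -⟩ := step ⟨n, by omega⟩ r1 r2
  simp [next] at s

end Chain

/-- for every integer `n ≥ 1` there exists a bridgeless cubic
class 2 graph `G` with a `(4 + 1/(n+1))`-bipartition `(B, W)` and a perfect
matching `M` such that `G` has the `M`-class-2 property and every edge of `M`
joins `B` to `W`. -/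
theorem statement_14 (n : ℕ) (hn : 1 ≤ n) :
    ∃ G : Multigraph, G.Bridgeless ∧ G.IsRegular 3 ∧ G.IsClass2 ∧
      ∃ (B W : Set G.V) (M : Set G.E),
        G.IsRBipartition (4 + 1 / ((n : ℝ) + 1)) B W ∧
        G.IsPerfectMatching M ∧
        G.MClass2Property M ∧
        ∀ e ∈ M, (G.tail e ∈ B ∧ G.head e ∈ W) ∨ (G.tail e ∈ W ∧ G.head e ∈ B) := by
  have hf : ∀ v : (Chain.GG n).V, (Chain.GG n).sg v (Chain.pp v) * Chain.fl (Chain.pp v) +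
      (Chain.GG n).sg v (Chain.qq v) * Chain.fl (Chain.qq v) +
      (Chain.GG n).sg v (Chain.rr v) * Chain.fl (Chain.rr v) = 0 := by
    intro v
    exact Chain.conserve_of _ Chain.sg_fun v
  have hne : Nonempty (Chain.GG n).V := ⟨(Sum.inl false : Chain.VV n)⟩
  have hc := Chain.listing (n := n) |>.class2 (M := Chain.MM n) Chain.rr_mem Chain.mem_inc
    Chain.no_col
  have hb := Chain.listing (n := n) |>.rbip Chain.fl (n + 1) (by omega)
    (fun e => (Chain.fl_bounds e).1) (fun e => (Chain.fl_bounds e).2) hf {v | Chain.inB v}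
    (by
      intro v hv
      exact Chain.sumB_of _ Chain.sg_fun v hv)
    (by
      intro v hv
      exact Chain.sumW_of _ Chain.sg_fun v hv)
  refine ⟨Chain.GG n, ?_, Chain.listing.regular, hc.1, {v | Chain.inB v}, {v | Chain.inB v}ᶜ,
    Chain.MM n, ?_, ?_, hc.2, ?_⟩
  · refine Chain.listing.bridgeless Chain.fl (fun e => ?_) hf
    have := (Chain.fl_bounds e).1
    push_cast at this
    omega
  · push_cast at hb
    exact hb
  · intro v
    exact ⟨Chain.rr v, ⟨Chain.rr_mem v, (Chain.listing.inc v _).2 (Or.inr (Or.inr rfl))⟩,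
      fun e he => Chain.mem_inc v e he.1 he.2⟩
  · intro e he
    exact Chain.MM_joins e he
end
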